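/- arXiv:1603.01799 — 4 statements merged into one kernel-verified Lean document; each statement's English description precedes it below -/
import Mathlib

section
/- There is a universal constant c > 0 such that for every n, every measurable function f : ℝ^n → [0,1], and every t > 0, one has E_{Y∼γ_n}[ M(f_{t,Y}) ] ≥ c (e^{2t} − 1) Var(P_t f). -/
open MeasureTheory Real

noncomputable def gauss (n : ℕ) : Measure (Fin n → ℝ) :=
  Measure.pi fun _ => ProbabilityTheory.gaussianReal 0 1

/-- Expectation with respect to the standard Gaussian measure on `ℝ^n`. -/
noncomputable def gExp (n : ℕ) (f : (Fin n → ℝ) → ℝ) : ℝ := ∫ x, f x ∂(gauss n)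

/-- Covariance with respect to the standard Gaussian measure on `ℝ^n`. -/
noncomputable def gCov (n : ℕ) (f g : (Fin n → ℝ) → ℝ) : ℝ :=
  gExp n (fun x => (f x - gExp n f) * (g x - gExp n g))

/-- Variance with respect to the standard Gaussian measure on `ℝ^n`. -/
noncomputable def gVar (n : ℕ) (f : (Fin n → ℝ) → ℝ) : ℝ := gCov n f f

/-- A half-space `{x : ⟨x, a⟩ ≤ b}` in `ℝ^n`. -/
def IsHalfspace {n : ℕ} (A : Set (Fin n → ℝ)) : Prop :=
  ∃ (a : Fin n → ℝ) (b : ℝ), A = {x | ∑ i, x i * a i ≤ b}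

/-- The Ornstein--Uhlenbeck semigroup `P_t`. -/
noncomputable def ou (n : ℕ) (t : ℝ) (f : (Fin n → ℝ) → ℝ) : (Fin n → ℝ) → ℝ :=
  fun x => ∫ y, f (fun i => Real.exp (-t) * x i + Real.sqrt (1 - Real.exp (-2*t)) * y i)
    ∂(gauss n)

/-- The shifted/rescaled function `f_{t,y}(x) = f(√(1-e^{-2t}) x + e^{-t} y)`. -/
noncomputable def shift (n : ℕ) (f : (Fin n → ℝ) → ℝ) (t : ℝ) (y : Fin n → ℝ) :
    (Fin n → ℝ) → ℝ :=
  fun x => f (fun i => Real.sqrt (1 - Real.exp (-2*t)) * x i + Real.exp (-t) * y i)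

/-- `M(g)`: the supremum over half-spaces `A` of `Cov(g, 1_A)`. -/
noncomputable def Mg (n : ℕ) (g : (Fin n → ℝ) → ℝ) : ℝ :=
  ⨆ A : {A : Set (Fin n → ℝ) // IsHalfspace A}, gCov n g (Set.indicator A.1 1)

/-- `w₁(f) = Σ_i (E[X_i f(X)])²`. -/
noncomputable def w1g (n : ℕ) (f : (Fin n → ℝ) → ℝ) : ℝ :=
  ∑ i : Fin n, (gExp n (fun x => x i * f x)) ^ 2

open ProbabilityTheory

instance gauss_prob (n : ℕ) : IsProbabilityMeasure (gauss n) := by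
  unfold gauss; infer_instance

instance gauss_gaussian (n : ℕ) : IsGaussian (gauss n) := by
  have h := map_pi_eq_stdGaussian (ι := Fin n)
  have h2 : gauss n = (stdGaussian (EuclideanSpace ℝ (Fin n))).map
      (EuclideanSpace.equiv (Fin n) ℝ) := by
    rw [← h, Measure.map_map (by fun_prop) (by fun_prop)]
    change gauss n = Measure.map id (gauss n)
    rw [Measure.map_id]
  rw [h2]; infer_instance

lemma coord_memLp (n : ℕ) (i : Fin n) (p : ENNReal) (hp : p ≠ ⊤) :
    MemLp (fun x : Fin n → ℝ => x i) p (gauss n) :=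
  IsGaussian.memLp_dual (gauss n) (ContinuousLinearMap.proj (R := ℝ) (φ := fun _ : Fin n => ℝ) i) p hp

lemma coord_integrable (n : ℕ) (i : Fin n) : Integrable (fun x : Fin n → ℝ => x i) (gauss n) :=
  memLp_one_iff_integrable.1 (coord_memLp n i 1 (by simp))

lemma lin_memLp (n : ℕ) (a : Fin n → ℝ) : MemLp (fun x : Fin n → ℝ => ∑ i, x i * a i) 2 (gauss n) :=
  memLp_finsetSum _ fun i _ => (coord_memLp n i 2 (by simp)).mul_const (a i)

lemma lin_integrable (n : ℕ) (a : Fin n → ℝ) :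
    Integrable (fun x : Fin n → ℝ => ∑ i, x i * a i) (gauss n) :=
  integrable_finsetSum _ fun i _ => (coord_integrable n i).mul_const (a i)

lemma coord_mean (n : ℕ) (i : Fin n) : ∫ x, x i ∂(gauss n) = 0 := by
  have := integral_comp_eval (μ := fun _ : Fin n => gaussianReal 0 1) (i := i) (f := fun x : ℝ => x)
    (by fun_prop)
  unfold gauss; rw [this]; simp

lemma lin_mean (n : ℕ) (a : Fin n → ℝ) : ∫ x, (∑ i, x i * a i) ∂(gauss n) = 0 := by
  rw [integral_finsetSum _ fun i _ => (coord_integrable n i).mul_const (a i)]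
  simp [integral_mul_const, coord_mean]

lemma lin_sq (n : ℕ) (a : Fin n → ℝ) :
    ∫ x, (∑ i, x i * a i) ^ 2 ∂(gauss n) = ∑ i, a i ^ 2 := by
  have h := variance_of_integral_eq_zero (lin_memLp n a).aemeasurable (lin_mean n a)
  rw [← h]
  have h2 := variance_sum_pi (μ := fun _ : Fin n => gaussianReal 0 1)
    (X := fun i (x : ℝ) => x * a i) (fun i => IsGaussian.memLp_two_id.mul_const _)
  have e : (fun x : Fin n → ℝ => ∑ i, x i * a i) = ∑ i, fun x : Fin n → ℝ => x i * a i := by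
    ext x; simp
  unfold gauss
  rw [e, h2]
  refine Finset.sum_congr rfl fun i _ => ?_
  change Var[fun x => id x * a i; gaussianReal 0 1] = _
  simp_rw [mul_comm _ (a i)]
  rw [variance_const_mul, variance_id_gaussianReal]; simp

lemma rot_inv (n : ℕ) (θ : ℝ) :
    MeasurePreserving (ContinuousLinearMap.rotation (E := Fin n → ℝ) θ)
      ((gauss n).prod (gauss n)) ((gauss n).prod (gauss n)) := by
  refine ⟨by fun_prop, IsGaussian.map_rotation_eq_self_of_forall_strongDual_eq_zero ?_ θ⟩
  intro L
  have : ∀ x : Fin n → ℝ, L x = ∑ i, x i * L (Pi.single i 1) := by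
    intro x
    conv_lhs => rw [pi_eq_sum_univ' x]
    simp
  rw [integral_congr_ae (ae_of_all _ this)]
  exact lin_mean n _

lemma gauss1_shift (u : ℝ) (s : Set ℝ) (hs : MeasurableSet s) :
    (gaussianReal 0 1).map (fun x => x + u) s =
      ENNReal.ofReal (∫ x, s.indicator (fun x => Real.exp (x * u - u ^ 2 / 2)) x ∂(gaussianReal 0 1)) := by
  rw [gaussianReal_map_add_const, gaussianReal_apply_eq_integral _ (by simp),
    integral_gaussianReal_eq_integral_smul (by simp), ← integral_indicator hs]
  congr 2
  ext x
  by_cases hx : x ∈ s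
  · simp only [Set.indicator_of_mem hx, gaussianPDFReal, smul_eq_mul, mul_assoc, ← Real.exp_add]
    congr 2
    simp; ring
  · simp [hx]

lemma exp_integrable1 (C : ℝ) : Integrable (fun x : ℝ => Real.exp (C * |x|)) (gaussianReal 0 1) := by
  refine Integrable.mono' ((integrable_exp_mul_gaussianReal C).add (integrable_exp_mul_gaussianReal (-C)))
    (by fun_prop) (ae_of_all _ fun x => ?_)
  simp only [Real.norm_eq_abs, Real.abs_exp, Pi.add_apply]
  rcases abs_choice x with h | h <;> rw [h]
  · have := Real.exp_pos (-C * x); linarith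
  · have := Real.exp_pos (C * x)
    rw [show C * -x = -C * x by ring]; linarith

lemma exp_integrable (n : ℕ) (C : ℝ) :
    Integrable (fun x : Fin n → ℝ => Real.exp (C * ∑ i, |x i|)) (gauss n) := by
  have := Integrable.fintype_prod (μ := fun _ : Fin n => gaussianReal 0 1) (fun _ => exp_integrable1 C)
  simp_rw [← Real.exp_sum, ← Finset.mul_sum] at this
  exact this

lemma expshift_integrable1 (u : ℝ) :
    Integrable (fun x : ℝ => Real.exp (x * u - u ^ 2 / 2)) (gaussianReal 0 1) := by
  have := (integrable_exp_mul_gaussianReal (μ := 0) (v := 1) u).mul_const (Real.exp (-(u^2/2)))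
  simp_rw [← Real.exp_add] at this
  refine this.congr (ae_of_all _ fun x => ?_)
  simp only; congr 1; ring

lemma gauss_shift_measure (n : ℕ) (u : Fin n → ℝ) :
    (gauss n).map (fun x => x + u) =
      (gauss n).withDensity (fun x => ENNReal.ofReal (Real.exp (∑ i, (x i * u i - u i ^ 2 / 2)))) := by
  have hm : (gauss n).map (fun x => x + u) =
      Measure.pi fun i => (gaussianReal 0 1).map (fun x => x + u i) := by
    have := Measure.pi_map_pi (μ := fun _ : Fin n => gaussianReal 0 1)
      (f := fun i x => x + u i) (fun i => by fun_prop)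
    rw [← this]; rfl
  rw [hm]
  have : ∀ i, IsProbabilityMeasure ((gaussianReal 0 1).map (fun x => x + u i)) :=
    fun i => Measure.isProbabilityMeasure_map (by fun_prop)
  refine Measure.pi_eq fun s hs => ?_
  simp_rw [fun i => gauss1_shift (u i) (s i) (hs i)]
  rw [← ENNReal.ofReal_prod_of_nonneg
    (fun i _ => integral_nonneg fun x => Set.indicator_nonneg (fun _ _ => (Real.exp_pos _).le) _)]
  have hint := Integrable.fintype_prod (μ := fun _ : Fin n => gaussianReal 0 1)
    (fun i => (expshift_integrable1 (u i)).indicator (hs i))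
  rw [withDensity_apply _ (MeasurableSet.univ_pi hs), ← lintegral_indicator (MeasurableSet.univ_pi hs),
    ← integral_fintype_prod_eq_prod (𝕜 := ℝ) (μ := fun _ : Fin n => gaussianReal 0 1)
     (fun i x => (s i).indicator (fun x => Real.exp (x * u i - u i ^ 2 / 2)) x),
    ofReal_integral_eq_lintegral_ofReal hint (ae_of_all _ fun x => Finset.prod_nonneg fun i _ =>
      Set.indicator_nonneg (fun _ _ => (Real.exp_pos _).le) _)]
  refine lintegral_congr fun x => ?_
  by_cases hx : x ∈ Set.univ.pi s
  · rw [Set.indicator_of_mem hx, Real.exp_sum]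
    congr 1
    refine Finset.prod_congr rfl fun i _ => ?_
    rw [Set.indicator_of_mem (hx i trivial)]
  · rw [Set.indicator_of_notMem hx]
    simp only [Set.mem_univ_pi, not_forall] at hx
    obtain ⟨i, hi⟩ := hx
    rw [Finset.prod_eq_zero (Finset.mem_univ i) (Set.indicator_of_notMem hi _)]
    simp

lemma gauss_shift (n : ℕ) (u : Fin n → ℝ) (h : (Fin n → ℝ) → ℝ) (hh : Measurable h) :
    ∫ x, h (x + u) ∂(gauss n) =
      ∫ x, h x * Real.exp (∑ i, (x i * u i - u i ^ 2 / 2)) ∂(gauss n) := by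
  rw [← integral_map (φ := fun x => x + u) (f := h) (by fun_prop) hh.aestronglyMeasurable,
    gauss_shift_measure, integral_withDensity_eq_integral_toReal_smul (by fun_prop) (by simp)]
  refine integral_congr_ae (ae_of_all _ fun x => ?_)
  simp only [smul_eq_mul]
  rw [ENNReal.toReal_ofReal (Real.exp_pos _).le, mul_comm]

lemma int01 {n : ℕ} {g : (Fin n → ℝ) → ℝ} (hg : Measurable g) (h01 : ∀ x, g x ∈ Set.Icc (0:ℝ) 1) :
    Integrable g (gauss n) :=
  Integrable.of_bound hg.aestronglyMeasurable 1 (ae_of_all _ fun x => by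
    rw [Real.norm_eq_abs, abs_le]; constructor <;> linarith [(h01 x).1, (h01 x).2])

lemma mean01 {n : ℕ} {g : (Fin n → ℝ) → ℝ} (hg : Measurable g) (h01 : ∀ x, g x ∈ Set.Icc (0:ℝ) 1) :
    gExp n g ∈ Set.Icc (0:ℝ) 1 := by
  refine ⟨integral_nonneg fun x => (h01 x).1, ?_⟩
  have := integral_mono (int01 hg h01) (integrable_const (1:ℝ)) (fun x => (h01 x).2)
  simpa [gExp] using this

lemma cent_abs {n : ℕ} {g : (Fin n → ℝ) → ℝ} (hg : Measurable g) (h01 : ∀ x, g x ∈ Set.Icc (0:ℝ) 1)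
    (x : Fin n → ℝ) : |g x - gExp n g| ≤ 1 := by
  have := mean01 hg h01
  rw [abs_le]; constructor <;> linarith [(h01 x).1, (h01 x).2, this.1, this.2]

lemma cov_eq {n : ℕ} {g k : (Fin n → ℝ) → ℝ} (hg : Measurable g)
    (h01 : ∀ x, g x ∈ Set.Icc (0:ℝ) 1) (hk : Integrable k (gauss n)) :
    gCov n g k = ∫ x, (g x - gExp n g) * k x ∂(gauss n) := by
  unfold gCov
  have h1 : Integrable (fun x => (g x - gExp n g) * k x) (gauss n) :=
    hk.bdd_mul (c := 1) (hg.sub_const _).aestronglyMeasurable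
      (ae_of_all _ fun x => cent_abs hg h01 x)
  have h0 : ∫ x, (g x - gExp n g) ∂(gauss n) = 0 := by
    rw [integral_sub (int01 hg h01) (integrable_const _)]
    simp [gExp]
  have h2 : Integrable (fun x => (g x - gExp n g) * gExp n k) (gauss n) :=
    ((int01 hg h01).sub (integrable_const _)).mul_const _
  change ∫ x, (g x - gExp n g) * (k x - gExp n k) ∂(gauss n) = _
  simp_rw [mul_sub]
  rw [integral_sub h1 h2, integral_mul_const, h0]
  simp

lemma half_meas {n : ℕ} (a : Fin n → ℝ) (b : ℝ) : MeasurableSet {x : Fin n → ℝ | ∑ i, x i * a i ≤ b} :=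
  measurableSet_le (by fun_prop) (by fun_prop)

lemma ind_int {n : ℕ} {A : Set (Fin n → ℝ)} (hA : MeasurableSet A) :
    Integrable (A.indicator (1 : (Fin n → ℝ) → ℝ)) (gauss n) :=
  (integrable_const (1:ℝ)).indicator hA

lemma cov_le {n : ℕ} {g : (Fin n → ℝ) → ℝ} (hg : Measurable g)
    (h01 : ∀ x, g x ∈ Set.Icc (0:ℝ) 1) {A : Set (Fin n → ℝ)} (hA : MeasurableSet A) :
    |gCov n g (A.indicator 1)| ≤ 1 := by
  rw [cov_eq hg h01 (ind_int hA)]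
  have := norm_integral_le_of_norm_le_const (μ := gauss n) (C := 1)
    (f := fun x => (g x - gExp n g) * A.indicator 1 x) (ae_of_all _ fun x => by
      rw [norm_mul, Real.norm_eq_abs]
      have h1 := cent_abs hg h01 x
      have h2 : ‖A.indicator (1 : (Fin n → ℝ) → ℝ) x‖ ≤ 1 := by
        by_cases hx : x ∈ A <;> simp [hx]
      exact mul_le_one₀ h1 (norm_nonneg _) h2)
  simpa using this

lemma half_ms {n : ℕ} {A : Set (Fin n → ℝ)} (hA : IsHalfspace A) : MeasurableSet A := by
  obtain ⟨a, b, rfl⟩ := hA; exact half_meas a b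

lemma M_bdd {n : ℕ} {g : (Fin n → ℝ) → ℝ} (hg : Measurable g)
    (h01 : ∀ x, g x ∈ Set.Icc (0:ℝ) 1) :
    BddAbove (Set.range fun A : {A : Set (Fin n → ℝ) // IsHalfspace A} =>
      gCov n g (Set.indicator A.1 1)) := by
  refine ⟨1, ?_⟩
  rintro _ ⟨A, rfl⟩
  exact (abs_le.1 (cov_le hg h01 (half_ms A.2))).2

lemma le_M {n : ℕ} {g : (Fin n → ℝ) → ℝ} (hg : Measurable g)
    (h01 : ∀ x, g x ∈ Set.Icc (0:ℝ) 1) (a : Fin n → ℝ) (b : ℝ) :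
    gCov n g (Set.indicator {x | ∑ i, x i * a i ≤ b} 1) ≤ Mg n g :=
  le_ciSup (M_bdd hg h01) ⟨_, a, b, rfl⟩

lemma clamp_int (s : ℝ) : ∫ b in Set.Icc (-2:ℝ) 2, (Set.Ici s).indicator (1 : ℝ → ℝ) b
    = 2 - max (-2) (min s 2) := by
  rw [setIntegral_indicator measurableSet_Ici]
  have : Set.Icc (-2:ℝ) 2 ∩ Set.Ici s = Set.Icc (max (-2) s) 2 := by
    ext b; simp only [Set.mem_inter_iff, Set.mem_Icc, Set.mem_Ici, max_le_iff]; tauto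
  rw [this]
  simp only [Pi.one_apply, integral_const, smul_eq_mul, mul_one, MeasurableSet.univ,
    measureReal_restrict_apply, Set.univ_inter, Real.volume_real_Icc]
  grind

lemma clamp_bd (s : ℝ) : |(2 - s) - (2 - max (-2) (min s 2))| ≤ s ^ 2 / 2 := by
  rw [abs_le]
  rcases le_total s 2 with h | h <;> rcases le_total (-2) s with h' | h'
  · rw [min_eq_left h, max_eq_right h']; constructor <;> nlinarith [sq_nonneg s]
  · rw [min_eq_left h, max_eq_left h']; constructor <;> nlinarith [sq_nonneg s]
  · rw [min_eq_right h, max_eq_right (by norm_num)]; constructor <;> nlinarith [sq_nonneg s]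
  · linarith

lemma w1_le_M {n : ℕ} {g : (Fin n → ℝ) → ℝ} (hg : Measurable g)
    (h01 : ∀ x, g x ∈ Set.Icc (0:ℝ) 1) : w1g n g ≤ 8 * Mg n g := by
  set a : Fin n → ℝ := fun i => - gExp n (fun x => x i * g x) with ha
  set S : (Fin n → ℝ) → ℝ := fun x => ∑ i, x i * a i with hS
  set m := gExp n g with hm
  have hSm : Measurable S := by fun_prop
  have hW : w1g n g = ∑ i, a i ^ 2 := by simp [w1g, ha]
  have hgi := int01 hg h01
  have hxg : ∀ i, Integrable (fun x : Fin n → ℝ => x i * g x) (gauss n) := fun i =>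
    (coord_integrable n i).mul_bdd (c := 1) hg.aestronglyMeasurable (ae_of_all _ fun x => by
      rw [Real.norm_eq_abs, abs_le]; constructor <;> linarith [(h01 x).1, (h01 x).2])
  have hSi : Integrable S (gauss n) := lin_integrable n a
  have hbd : ∀ᵐ x ∂(gauss n), ‖g x - m‖ ≤ 1 := ae_of_all _ fun x => cent_abs hg h01 x
  have hgm : AEStronglyMeasurable (fun x => g x - m) (gauss n) :=
    (hg.sub_const _).aestronglyMeasurable
  -- E[(g-m)(2-S)] = W
  have e1 : ∫ x, (g x - m) * (2 - S x) ∂(gauss n) = w1g n g := by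
    have hs1 : ∫ x, S x * g x ∂(gauss n) = - w1g n g := by
      have : ∀ x, S x * g x = ∑ i, (x i * g x) * a i := fun x => by
        rw [hS, Finset.sum_mul]; exact Finset.sum_congr rfl fun i _ => by ring
      simp_rw [this]
      rw [integral_finsetSum _ fun i _ => (hxg i).mul_const _, hW, ← Finset.sum_neg_distrib]
      refine Finset.sum_congr rfl fun i _ => ?_
      rw [integral_mul_const]
      have : ∫ x, x i * g x ∂(gauss n) = - a i := by simp [ha, gExp]
      rw [this]; ring
    have hSg : Integrable (fun x => S x * g x) (gauss n) :=
      hSi.mul_bdd (c := 1) hg.aestronglyMeasurable (ae_of_all _ fun x => by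
        rw [Real.norm_eq_abs, abs_le]; constructor <;> linarith [(h01 x).1, (h01 x).2])
    have : ∀ x, (g x - m) * (2 - S x) = (g x - m) * 2 - S x * g x + S x * m := fun x => by ring
    simp_rw [this]
    have i1 : Integrable (fun x => (g x - m) * 2) (gauss n) :=
      (hgi.sub (integrable_const _)).mul_const _
    have i2 : Integrable (fun x => (g x - m) * 2 - S x * g x) (gauss n) := i1.sub hSg
    rw [integral_add i2 (hSi.mul_const _), integral_sub i1 hSg, integral_mul_const, integral_mul_const,
      integral_sub hgi (integrable_const _), hs1, lin_mean n a]
    simp [hm, gExp]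
  set k : (Fin n → ℝ) → ℝ := fun x => 2 - max (-2) (min (S x) 2) with hk
  have hkm : Measurable k := by fun_prop
  have hki : Integrable k (gauss n) := Integrable.of_bound hkm.aestronglyMeasurable 4
    (ae_of_all _ fun x => by simp only [hk, Real.norm_eq_abs]; grind)
  -- Fubini
  have e2 : ∫ x, (g x - m) * k x ∂(gauss n) =
      ∫ b in Set.Icc (-2:ℝ) 2, gCov n g (Set.indicator {x | S x ≤ b} 1) := by
    have c1 : ∀ b, gCov n g (Set.indicator {x | S x ≤ b} 1) =
        ∫ x, (g x - m) * (Set.Ici (S x)).indicator (1 : ℝ → ℝ) b ∂(gauss n) := fun b => by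
      rw [cov_eq hg h01 (ind_int (half_meas a b))]
      refine integral_congr_ae (ae_of_all _ fun x => ?_)
      simp only [Set.indicator_apply, Set.mem_ofPred_eq, Set.mem_Ici, Pi.one_apply]
      rfl
    simp_rw [c1]
    rw [integral_integral_swap]
    · refine integral_congr_ae (ae_of_all _ fun x => ?_)
      simp only
      rw [integral_const_mul, clamp_int]
    · have hset : MeasurableSet {p : ℝ × (Fin n → ℝ) | S p.2 ≤ p.1} :=
        measurableSet_le (by fun_prop) (by fun_prop)
      have heq : (Function.uncurry fun (b : ℝ) (x : Fin n → ℝ) =>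
          (g x - m) * (Set.Ici (S x)).indicator (1 : ℝ → ℝ) b) =
          fun p => (g p.2 - m) * Set.indicator {p : ℝ × (Fin n → ℝ) | S p.2 ≤ p.1} 1 p := by
        ext ⟨b, x⟩
        simp [Function.uncurry, Set.indicator_apply]
      rw [heq]
      refine Integrable.of_bound (((hg.comp measurable_snd).sub_const m).mul
        (measurable_one.indicator hset)).aestronglyMeasurable 1 (ae_of_all _ fun p => ?_)
      rw [norm_mul, Real.norm_eq_abs]
      refine mul_le_one₀ (cent_abs hg h01 p.2) (norm_nonneg _) ?_
      rw [Set.indicator_apply]; split_ifs <;> simp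
  have e3 : ∫ x, (g x - m) * k x ∂(gauss n) ≤ 4 * Mg n g := by
    rw [e2]
    have h4 : ∫ b in Set.Icc (-2:ℝ) 2, Mg n g = 4 * Mg n g := by
      simp [Real.volume_real_Icc]; norm_num
    rw [← h4]
    by_cases hi : IntegrableOn (fun b => gCov n g (Set.indicator {x | S x ≤ b} 1)) (Set.Icc (-2:ℝ) 2)
    · exact integral_mono hi (by simp) fun b => le_M hg h01 a b
    · rw [integral_undef hi, h4]
      have h0 := le_M hg h01 0 0
      have : gCov n g (Set.indicator {x | ∑ i, x i * (0 : Fin n → ℝ) i ≤ 0} 1) = 0 := by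
        simp [gCov, gExp]
      linarith
  have e4 : ∫ x, (g x - m) * (2 - S x) ∂(gauss n) - ∫ x, (g x - m) * k x ∂(gauss n)
      ≤ w1g n g / 2 := by
    have i1 : Integrable (fun x => 2 - S x) (gauss n) := (integrable_const _).sub hSi
    have i2 : Integrable (fun x => (g x - m) * (2 - S x)) (gauss n) := i1.bdd_mul hgm hbd
    have i3 : Integrable (fun x => (g x - m) * k x) (gauss n) := hki.bdd_mul hgm hbd
    rw [← integral_sub i2 i3, hW,
      ← lin_sq n a, ← integral_div]
    refine integral_mono (i2.sub i3)
      ((lin_memLp n a).integrable_sq.div_const _) fun x => ?_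
    have h1 := clamp_bd (S x)
    have h2 := cent_abs hg h01 x
    simp only
    rw [← mul_sub]
    calc _ ≤ |(g x - m) * ((2 - S x) - k x)| := le_abs_self _
      _ = |g x - m| * |(2 - S x) - k x| := abs_mul _ _
      _ ≤ 1 * (S x ^ 2 / 2) := mul_le_mul h2 h1 (abs_nonneg _) (by norm_num)
      _ = _ := one_mul _
  linarith

lemma shift_meas2 {n : ℕ} {f : (Fin n → ℝ) → ℝ} (hf : Measurable f) (t : ℝ) :
    Measurable (fun p : (Fin n → ℝ) × (Fin n → ℝ) => shift n f t p.1 p.2) := by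
  unfold shift
  exact hf.comp (by fun_prop)

lemma shift_meas {n : ℕ} {f : (Fin n → ℝ) → ℝ} (hf : Measurable f) (t : ℝ) (y : Fin n → ℝ) :
    Measurable (shift n f t y) := (shift_meas2 hf t).comp measurable_prodMk_left

lemma cov_tendsto {n : ℕ} {g : (Fin n → ℝ) → ℝ} (hg : Measurable g)
    (h01 : ∀ x, g x ∈ Set.Icc (0:ℝ) 1) (A : Set (Fin n → ℝ)) (B : ℕ → Set (Fin n → ℝ))
    (hA : MeasurableSet A) (hB : ∀ k, MeasurableSet (B k))
    (h : ∀ x, ∀ᶠ k in Filter.atTop, (x ∈ B k ↔ x ∈ A)) :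
    Filter.Tendsto (fun k => gCov n g ((B k).indicator 1)) Filter.atTop
      (nhds (gCov n g (A.indicator 1))) := by
  simp_rw [fun k => cov_eq hg h01 (ind_int (hB k)), cov_eq hg h01 (ind_int hA)]
  refine tendsto_integral_of_dominated_convergence (fun _ => 1) ?_ (integrable_const _) ?_ ?_
  · exact fun k => ((hg.sub_const _).mul (measurable_one.indicator (hB k))).aestronglyMeasurable
  · refine fun k => ae_of_all _ fun x => ?_
    rw [norm_mul, Real.norm_eq_abs]
    refine mul_le_one₀ (cent_abs hg h01 x) (norm_nonneg _) ?_
    by_cases hx : x ∈ B k <;> simp [hx]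
  · refine ae_of_all _ fun x => ?_
    refine Filter.Tendsto.congr' ?_ tendsto_const_nhds
    filter_upwards [h x] with k hk
    by_cases hx : x ∈ A
    · simp [hx, hk.2 hx]
    · have hx' : x ∉ B k := fun h => hx (hk.1 h)
      simp [hx, hx']

lemma M_rat {n : ℕ} {g : (Fin n → ℝ) → ℝ} (hg : Measurable g)
    (h01 : ∀ x, g x ∈ Set.Icc (0:ℝ) 1) :
    Mg n g = ⨆ q : (Fin n → ℚ) × ℚ,
      gCov n g (Set.indicator {x | ∑ i, x i * (q.1 i : ℝ) ≤ (q.2 : ℝ)} 1) := by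
  have hb : BddAbove (Set.range fun q : (Fin n → ℚ) × ℚ =>
      gCov n g (Set.indicator {x | ∑ i, x i * (q.1 i : ℝ) ≤ (q.2 : ℝ)} 1)) := by
    refine ⟨1, ?_⟩
    rintro _ ⟨q, rfl⟩
    exact (abs_le.1 (cov_le hg h01 (half_meas _ _))).2
  apply le_antisymm
  · have : Nonempty {A : Set (Fin n → ℝ) // IsHalfspace A} := ⟨⟨_, 0, 0, rfl⟩⟩
    refine ciSup_le ?_
    rintro ⟨_, a, b, rfl⟩
    have hq : ∀ (k : ℕ) (i : Fin n), ∃ q : ℚ, |(q:ℝ) - a i| < 1 / ((k:ℝ) + 1) ^ 2 := fun k i => by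
      obtain ⟨q, h1, h2⟩ := exists_rat_btwn (show a i < a i + 1 / ((k:ℝ) + 1) ^ 2 by
        have : 0 < 1 / ((k:ℝ) + 1) ^ 2 := by positivity
        linarith)
      exact ⟨q, by rw [abs_lt]; constructor <;> linarith⟩
    choose q hq using hq
    have hc : ∀ k : ℕ, ∃ c : ℚ, b + 1 / ((k:ℝ) + 1) < c ∧ (c:ℝ) < b + 2 / ((k:ℝ) + 1) := fun k =>
      exists_rat_btwn (by
        have : 1 / ((k:ℝ) + 1) < 2 / ((k:ℝ) + 1) := by gcongr; norm_num
        linarith)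
    choose c hc1 hc2 using hc
    have key := cov_tendsto hg h01 {x | ∑ i, x i * a i ≤ b}
      (fun k => {x | ∑ i, x i * (q k i : ℝ) ≤ (c k : ℝ)}) (half_meas _ _) (fun k => half_meas _ _) ?_
    · exact le_of_tendsto' key fun k => le_ciSup hb (q k, c k)
    · intro x
      set R := ∑ i, |x i| with hR
      have hR0 : 0 ≤ R := Finset.sum_nonneg fun i _ => abs_nonneg _
      have hd : ∀ k, |∑ i, x i * (q k i : ℝ) - ∑ i, x i * a i| ≤ R / ((k:ℝ) + 1) ^ 2 := fun k => by
        rw [← Finset.sum_sub_distrib, hR, Finset.sum_div]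
        refine (Finset.abs_sum_le_sum_abs _ _).trans (Finset.sum_le_sum fun i _ => ?_)
        rw [← mul_sub, abs_mul, div_eq_mul_one_div]
        exact mul_le_mul_of_nonneg_left (hq k i).le (abs_nonneg _)
      by_cases hx : ∑ i, x i * a i ≤ b
      · obtain ⟨N, hN⟩ := exists_nat_ge R
        filter_upwards [Filter.eventually_ge_atTop N] with k hk
        have hk' : (N:ℝ) ≤ k := by exact_mod_cast hk
        simp only [hx, iff_true]
        have h1 := (abs_le.1 (hd k)).2
        have h2 : R / ((k:ℝ) + 1) ^ 2 ≤ 1 / ((k:ℝ) + 1) := by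
          rw [div_le_div_iff₀ (by positivity) (by positivity)]
          nlinarith
        linarith [hc1 k]
      · push Not at hx
        obtain ⟨N, hN⟩ := exists_nat_ge ((R + 2) / (∑ i, x i * a i - b))
        filter_upwards [Filter.eventually_ge_atTop N] with k hk
        have hk' : (N:ℝ) ≤ k := by exact_mod_cast hk
        simp only [not_le.2 hx, iff_false, not_le]
        have h1 := (abs_le.1 (hd k)).1
        have hk0 : (1:ℝ) ≤ (k:ℝ) + 1 := by linarith [(Nat.cast_nonneg k : (0:ℝ) ≤ k)]
        have h2 : R / ((k:ℝ) + 1) ^ 2 ≤ R / ((k:ℝ) + 1) := by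
          gcongr; nlinarith
        have h3 : R / ((k:ℝ) + 1) + 2 / ((k:ℝ) + 1) < ∑ i, x i * a i - b := by
          rw [← add_div, div_lt_iff₀ (by linarith)]
          have := hN.trans hk'
          rw [div_le_iff₀ (by linarith)] at this
          nlinarith
        linarith [hc2 k]
  · exact ciSup_le fun q => le_M hg h01 _ _

lemma M_meas {n : ℕ} {f : (Fin n → ℝ) → ℝ} (hf : Measurable f) (h01 : ∀ x, f x ∈ Set.Icc (0:ℝ) 1)
    (t : ℝ) : Measurable (fun y => Mg n (shift n f t y)) := by
  have : (fun y => Mg n (shift n f t y)) = fun y => ⨆ q : (Fin n → ℚ) × ℚ,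
      gCov n (shift n f t y) (Set.indicator {x | ∑ i, x i * (q.1 i : ℝ) ≤ (q.2 : ℝ)} 1) :=
    funext fun y => M_rat (shift_meas hf t y) fun x => h01 _
  rw [this]
  refine Measurable.iSup fun q => ?_
  set A := {x : Fin n → ℝ | ∑ i, x i * (q.1 i : ℝ) ≤ (q.2 : ℝ)} with hA
  have hAm : MeasurableSet A := half_meas _ _
  have hE : Measurable fun y => gExp n (shift n f t y) :=
    ((shift_meas2 hf t).stronglyMeasurable.integral_prod_right' (ν := gauss n)).measurable
  have hj : Measurable fun p : (Fin n → ℝ) × (Fin n → ℝ) =>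
      (shift n f t p.1 p.2 - gExp n (shift n f t p.1)) * (A.indicator 1 p.2 - gExp n (A.indicator 1)) :=
    ((shift_meas2 hf t).sub (hE.comp measurable_fst)).mul
      (((measurable_one.indicator hAm).comp measurable_snd).sub_const _)
  exact (hj.stronglyMeasurable.integral_prod_right' (ν := gauss n)).measurable

lemma M_int {n : ℕ} {f : (Fin n → ℝ) → ℝ} (hf : Measurable f) (h01 : ∀ x, f x ∈ Set.Icc (0:ℝ) 1)
    (t : ℝ) : Integrable (fun y => Mg n (shift n f t y)) (gauss n) := by
  refine Integrable.of_bound (M_meas hf h01 t).aestronglyMeasurable 1 (ae_of_all _ fun y => ?_)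
  have hs := shift_meas hf t y
  have hs01 : ∀ x, shift n f t y x ∈ Set.Icc (0:ℝ) 1 := fun x => h01 _
  have : Nonempty {A : Set (Fin n → ℝ) // IsHalfspace A} := ⟨⟨_, 0, 0, rfl⟩⟩
  have h1 : Mg n (shift n f t y) ≤ 1 :=
    ciSup_le fun A => (abs_le.1 (cov_le hs hs01 (half_ms A.2))).2
  have h2 := le_M hs hs01 0 0
  have h3 := (abs_le.1 (cov_le hs hs01 (half_meas 0 0))).1
  rw [Real.norm_eq_abs, abs_le]; constructor <;> linarith

lemma deriv_lem {n : ℕ} {p : (Fin n → ℝ) → ℝ} (hp : Measurable p) (hp1 : ∀ x, |p x| ≤ 1)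
    (u u' : ℝ → Fin n → ℝ) (hu : ∀ θ i, HasDerivAt (fun θ => u θ i) (u' θ i) θ) (C : ℝ)
    (hC : ∀ θ i, |u θ i| ≤ C) (hC' : ∀ θ i, |u' θ i| ≤ C) (hC0 : 0 ≤ C) (θ₀ : ℝ) (h0 : u θ₀ = 0) :
    HasDerivAt (fun θ => ∫ x, p (x + u θ) ∂(gauss n))
      (∫ x, p x * ∑ i, x i * u' θ₀ i ∂(gauss n)) θ₀ := by
  simp_rw [fun θ => gauss_shift n (u θ) p hp]
  have key := hasDerivAt_integral_of_dominated_loc_of_deriv_le (μ := gauss n) (s := Set.univ) (x₀ := θ₀)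
    (F := fun θ x => p x * Real.exp (∑ i, (x i * u θ i - u θ i ^ 2 / 2)))
    (F' := fun θ x => p x * (Real.exp (∑ i, (x i * u θ i - u θ i ^ 2 / 2)) *
      ∑ i, (x i * u' θ i - u θ i * u' θ i)))
    (bound := fun x => Real.exp (n * C ^ 2) * Real.exp ((2 * C) * ∑ i, |x i|))
    Filter.univ_mem
    (Filter.Eventually.of_forall fun θ => by
      exact (hp.mul (by fun_prop)).aestronglyMeasurable)
    (by
      simp only [h0]
      simpa using Integrable.of_bound hp.aestronglyMeasurable 1 (ae_of_all _ hp1))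
    ((hp.mul (by fun_prop)).aestronglyMeasurable)
    (ae_of_all _ fun x θ _ => by
      have hS : ∀ v : Fin n → ℝ, (∀ i, |v i| ≤ C) → |∑ i, x i * v i| ≤ C * ∑ i, |x i| := fun v hv => by
        rw [Finset.mul_sum]
        refine (Finset.abs_sum_le_sum_abs _ _).trans (Finset.sum_le_sum fun i _ => ?_)
        rw [abs_mul, mul_comm]
        exact mul_le_mul_of_nonneg_right (hv i) (abs_nonneg _)
      have h1 : ∑ i, (x i * u θ i - u θ i ^ 2 / 2) ≤ C * ∑ i, |x i| := by
        rw [Finset.sum_sub_distrib]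
        have := (abs_le.1 (hS (u θ) (hC θ))).2
        have h2 : 0 ≤ ∑ i, u θ i ^ 2 / 2 := Finset.sum_nonneg fun i _ => by positivity
        linarith
      have h2 : |∑ i, (x i * u' θ i - u θ i * u' θ i)| ≤ C * ∑ i, |x i| + n * C ^ 2 := by
        rw [Finset.sum_sub_distrib]
        refine (abs_sub _ _).trans (add_le_add (hS _ (hC' θ)) ?_)
        refine (Finset.abs_sum_le_sum_abs _ _).trans ?_
        refine (Finset.sum_le_card_nsmul _ _ (C ^ 2) fun i _ => ?_).trans (by simp)
        rw [abs_mul, sq]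
        exact mul_le_mul (hC θ i) (hC' θ i) (abs_nonneg _) hC0
      have h3 : C * ∑ i, |x i| + n * C ^ 2 ≤ Real.exp (C * ∑ i, |x i| + n * C ^ 2) := by
        have := Real.add_one_le_exp (C * ∑ i, |x i| + n * C ^ 2); linarith
      rw [norm_mul, norm_mul, Real.norm_eq_abs, Real.norm_eq_abs, Real.norm_eq_abs, Real.abs_exp]
      calc _ ≤ 1 * (Real.exp (C * ∑ i, |x i|) * Real.exp (C * ∑ i, |x i| + n * C ^ 2)) := by
            refine mul_le_mul (hp1 x) ?_ (by positivity) (by norm_num)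
            exact mul_le_mul (Real.exp_le_exp.2 h1) (h2.trans h3) (abs_nonneg _) (Real.exp_pos _).le
        _ = _ := by
            rw [one_mul, ← Real.exp_add, ← Real.exp_add]; congr 1; ring)
    ((exp_integrable n (2 * C)).const_mul _)
    (ae_of_all _ fun x θ _ => by
      refine HasDerivAt.const_mul _ (HasDerivAt.exp ?_)
      refine HasDerivAt.fun_sum fun i _ => ?_
      have := ((hu θ i).const_mul (x i)).sub (((hu θ i).pow 2).div_const 2)
      refine this.congr_deriv ?_
      simp; ring)
  refine key.2.congr_deriv ?_
  refine integral_congr_ae (ae_of_all _ fun x => ?_)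
  simp [h0]

/-- First-level Gaussian coefficients of the shifted function. -/
noncomputable def WW (n : ℕ) (f : (Fin n → ℝ) → ℝ) (t : ℝ) (y : Fin n → ℝ) (i : Fin n) : ℝ :=
  gExp n (fun x => x i * shift n f t y x)

lemma WW_meas {n : ℕ} {f : (Fin n → ℝ) → ℝ} (hf : Measurable f) (t : ℝ) (i : Fin n) :
    Measurable (fun y => WW n f t y i) := by
  have hj : Measurable fun p : (Fin n → ℝ) × (Fin n → ℝ) => p.2 i * shift n f t p.1 p.2 :=
    (by fun_prop : Measurable fun p : (Fin n → ℝ) × (Fin n → ℝ) => p.2 i).mul (shift_meas2 hf t)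
  exact (hj.stronglyMeasurable.integral_prod_right' (ν := gauss n)).measurable

lemma abs01 {r : ℝ} (h : r ∈ Set.Icc (0:ℝ) 1) : |r| ≤ 1 := by
  rw [abs_le]; constructor <;> linarith [h.1, h.2]

lemma xg_int {n : ℕ} {g : (Fin n → ℝ) → ℝ} (hg : Measurable g)
    (h01 : ∀ x, g x ∈ Set.Icc (0:ℝ) 1) (i : Fin n) :
    Integrable (fun x : Fin n → ℝ => x i * g x) (gauss n) :=
  (coord_integrable n i).mul_bdd (c := 1) hg.aestronglyMeasurable (ae_of_all _ fun x => abs01 (h01 x))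

lemma WW_bd {n : ℕ} {f : (Fin n → ℝ) → ℝ} (hf : Measurable f) (h01 : ∀ x, f x ∈ Set.Icc (0:ℝ) 1)
    (t : ℝ) (y : Fin n → ℝ) (i : Fin n) : |WW n f t y i| ≤ ∫ x, |x i| ∂(gauss n) := by
  refine (norm_integral_le_integral_norm (μ := gauss n) (fun x => x i * shift n f t y x)).trans ?_
  refine integral_mono (xg_int (shift_meas hf t y) (fun x => h01 _) i).norm
    (coord_integrable n i).norm fun x => ?_
  simp only [norm_mul, Real.norm_eq_abs]
  exact mul_le_of_le_one_right (abs_nonneg _) (abs01 (h01 _))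

lemma path_deriv {n : ℕ} {f : (Fin n → ℝ) → ℝ} (hf : Measurable f)
    (h01 : ∀ x, f x ∈ Set.Icc (0:ℝ) 1) (t : ℝ) (ht : 0 < t) (a b : Fin n → ℝ) (θ₀ : ℝ) :
    HasDerivAt (fun θ => ou n t f (Real.cos θ • a + Real.sin θ • b))
      (∑ i, (-Real.sin θ₀ • a + Real.cos θ₀ • b) i * ((Real.exp (-t) / Real.sqrt (1 - Real.exp (-2*t))) *
        WW n f t (Real.cos θ₀ • a + Real.sin θ₀ • b) i)) θ₀ := by
  set r := Real.exp (-t) with hr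
  set s := Real.sqrt (1 - Real.exp (-2*t)) with hs
  have hs0 : 0 < s := Real.sqrt_pos.2 (by
    have : Real.exp (-2*t) < 1 := Real.exp_lt_one_iff.2 (by linarith)
    linarith)
  have hr0 : 0 < r := Real.exp_pos _
  set y₀ := Real.cos θ₀ • a + Real.sin θ₀ • b with hy
  set p := shift n f t y₀ with hp
  have hpm : Measurable p := shift_meas hf t y₀
  set B := ∑ i, (|a i| + |b i|) with hB
  have hB0 : 0 ≤ B := Finset.sum_nonneg fun i _ => by positivity
  have hBi : ∀ i, |a i| + |b i| ≤ B := fun i =>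
    Finset.single_le_sum (f := fun i => |a i| + |b i|) (fun i _ => by positivity) (Finset.mem_univ i)
  have hcs : ∀ (α β : ℝ) (i : Fin n), |α| ≤ 1 → |β| ≤ 1 → |α * a i + β * b i| ≤ B := fun α β i h1 h2 => by
    refine (abs_add_le _ _).trans (le_trans ?_ (hBi i))
    rw [abs_mul, abs_mul]
    exact add_le_add (mul_le_of_le_one_left (abs_nonneg _) h1) (mul_le_of_le_one_left (abs_nonneg _) h2)
  have key := deriv_lem hpm (fun x => abs01 (h01 _))
    (fun θ i => (r / s) * ((Real.cos θ * a i + Real.sin θ * b i) - y₀ i))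
    (fun θ i => (r / s) * (-Real.sin θ * a i + Real.cos θ * b i))
    (fun θ i => by
      refine HasDerivAt.const_mul _ (HasDerivAt.sub_const _ ?_)
      exact ((Real.hasDerivAt_cos θ).mul_const _).add ((Real.hasDerivAt_sin θ).mul_const _))
    ((r / s) * (2 * B))
    (fun θ i => by
      rw [abs_mul, abs_of_pos (div_pos hr0 hs0)]
      refine mul_le_mul_of_nonneg_left ?_ (div_pos hr0 hs0).le
      refine (abs_sub _ _).trans ?_
      have h1 := hcs (Real.cos θ) (Real.sin θ) i (Real.abs_cos_le_one _) (Real.abs_sin_le_one _)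
      have h2 := hcs (Real.cos θ₀) (Real.sin θ₀) i (Real.abs_cos_le_one _) (Real.abs_sin_le_one _)
      have : y₀ i = Real.cos θ₀ * a i + Real.sin θ₀ * b i := by simp [hy]
      rw [this]; linarith)
    (fun θ i => by
      rw [abs_mul, abs_of_pos (div_pos hr0 hs0)]
      refine mul_le_mul_of_nonneg_left ?_ (div_pos hr0 hs0).le
      have h1 := hcs (-Real.sin θ) (Real.cos θ) i (by rw [abs_neg]; exact Real.abs_sin_le_one _)
        (Real.abs_cos_le_one _)
      linarith)
    (by positivity) θ₀ (by ext i; simp [hy])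
  have hfun : (fun θ => ou n t f (Real.cos θ • a + Real.sin θ • b)) =
      fun θ => ∫ x, p (x + fun i => (r / s) * ((Real.cos θ * a i + Real.sin θ * b i) - y₀ i)) ∂(gauss n) := by
    ext θ
    refine integral_congr_ae (ae_of_all _ fun x => ?_)
    simp only [hp, shift]
    congr 1
    ext i
    simp only [Pi.add_apply, Pi.smul_apply, smul_eq_mul, ← hr, ← hs]
    field_simp
    ring
  rw [hfun]
  refine key.congr_deriv ?_
  simp_rw [Finset.mul_sum]
  have hi : ∀ i ∈ Finset.univ, Integrable (fun x : Fin n → ℝ =>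
      p x * (x i * ((r / s) * (-Real.sin θ₀ * a i + Real.cos θ₀ * b i)))) (gauss n) := fun i _ => by
    refine ((xg_int hpm (fun x => h01 _) i).mul_const
      ((r / s) * (-Real.sin θ₀ * a i + Real.cos θ₀ * b i))).congr (ae_of_all _ fun x => ?_)
    simp only; ring
  rw [integral_finsetSum _ hi]
  refine Finset.sum_congr rfl fun i _ => ?_
  have : ∀ x : Fin n → ℝ, p x * (x i * ((r / s) * (-Real.sin θ₀ * a i + Real.cos θ₀ * b i))) =
    (x i * p x) * ((r / s) * (-Real.sin θ₀ * a i + Real.cos θ₀ * b i)) := fun x => by ring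
  simp_rw [this]
  rw [integral_mul_const]
  simp only [WW, gExp, Pi.add_apply, Pi.smul_apply, smul_eq_mul]
  ring

lemma cs_lem {α : Type*} [MeasurableSpace α] (μ : Measure α) [IsFiniteMeasure μ] (L : ℝ) (hL : 0 < L)
    (hμ : μ.real Set.univ = L) (D : α → ℝ) (h1 : Integrable D μ) (h2 : Integrable (fun x => D x ^ 2) μ) :
    (∫ x, D x ∂μ) ^ 2 ≤ L * ∫ x, D x ^ 2 ∂μ := by
  set J := ∫ x, D x ∂μ with hJ
  have h : 0 ≤ ∫ x, (L * D x - J) ^ 2 ∂μ := integral_nonneg fun x => sq_nonneg _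
  have e : ∀ x, (L * D x - J) ^ 2 = L ^ 2 * D x ^ 2 - (2 * L * J) * D x + J ^ 2 := fun x => by ring
  simp_rw [e] at h
  have i1 : Integrable (fun x => L ^ 2 * D x ^ 2 - (2 * L * J) * D x) μ :=
    (h2.const_mul _).sub (h1.const_mul _)
  rw [integral_add i1 (integrable_const _), integral_sub (h2.const_mul _) (h1.const_mul _),
    integral_const_mul, integral_const_mul, ← hJ, integral_const, hμ, smul_eq_mul] at h
  have : 0 ≤ L * (L * ∫ x, D x ^ 2 ∂μ - J ^ 2) := by nlinarith
  have := nonneg_of_mul_nonneg_right this hL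
  linarith

lemma two_var {n : ℕ} {F : (Fin n → ℝ) → ℝ} (hF : Measurable F) (h01 : ∀ x, F x ∈ Set.Icc (0:ℝ) 1) :
    ∫ p, (F p.2 - F p.1) ^ 2 ∂((gauss n).prod (gauss n)) = 2 * gVar n F := by
  set m := gExp n F with hm
  have hFi := int01 hF h01
  have hi : Integrable (fun x => F x - m) (gauss n) := hFi.sub (integrable_const _)
  have h0 : ∫ x, (F x - m) ∂(gauss n) = 0 := by
    rw [integral_sub hFi (integrable_const _)]; simp [hm, gExp]
  have hsq : Integrable (fun x => (F x - m) * (F x - m)) (gauss n) :=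
    hi.mul_bdd (c := 1) hi.aestronglyMeasurable (ae_of_all _ fun x => cent_abs hF h01 x)
  have e : ∀ p : (Fin n → ℝ) × (Fin n → ℝ), (F p.2 - F p.1) ^ 2 =
      (F p.1 - m) * (F p.1 - m) + (F p.2 - m) * (F p.2 - m) - 2 * ((F p.1 - m) * (F p.2 - m)) := fun p => by ring
  simp_rw [e]
  have i1 := hsq.comp_fst (ν := gauss n)
  have i2 := hsq.comp_snd (μ := gauss n)
  have i3 := (hi.mul_prod hi).const_mul 2
  have i4 : Integrable (fun p : (Fin n → ℝ) × (Fin n → ℝ) =>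
      (F p.1 - m) * (F p.1 - m) + (F p.2 - m) * (F p.2 - m)) ((gauss n).prod (gauss n)) := i1.add i2
  rw [integral_sub i4 i3, integral_add i1 i2, integral_const_mul,
    integral_prod_mul (fun x => F x - m) (fun x => F x - m), h0,
    integral_fun_fst (fun x => (F x - m) * (F x - m)), integral_fun_snd (fun x => (F x - m) * (F x - m))]
  simp only [probReal_univ, one_smul, gVar, gCov]
  change _ = 2 * ∫ x, (F x - m) * (F x - m) ∂(gauss n)
  ring

set_option maxHeartbeats 1000000 in
lemma poinc {n : ℕ} {f : (Fin n → ℝ) → ℝ} (hf : Measurable f)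
    (h01 : ∀ x, f x ∈ Set.Icc (0:ℝ) 1) (t : ℝ) (ht : 0 < t) :
    2 * gVar n (ou n t f) ≤ (π / 2) * ((π / 2) * ((Real.exp (-t) / Real.sqrt (1 - Real.exp (-2*t))) ^ 2 *
      ∫ y, w1g n (shift n f t y) ∂(gauss n))) ∧
    Integrable (fun y => w1g n (shift n f t y)) (gauss n) := by
  set ρ := Real.exp (-t) / Real.sqrt (1 - Real.exp (-2*t)) with hρ
  set F := ou n t f with hF
  have hpi : (0:ℝ) < π / 2 := by positivity
  have houm : Measurable F := by
    have hj : Measurable fun p : (Fin n → ℝ) × (Fin n → ℝ) => f (fun i => Real.exp (-t) * p.1 i +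
        Real.sqrt (1 - Real.exp (-2*t)) * p.2 i) := hf.comp (by fun_prop)
    exact (hj.stronglyMeasurable.integral_prod_right' (ν := gauss n)).measurable
  have hou01 : ∀ x, F x ∈ Set.Icc (0:ℝ) 1 := fun x =>
    mean01 (g := fun y => f (fun i => Real.exp (-t) * x i + Real.sqrt (1 - Real.exp (-2*t)) * y i))
      (hf.comp (by fun_prop)) (fun _ => h01 _)
  have hWm := fun i => WW_meas hf t i
  have hw1 : ∀ y, w1g n (shift n f t y) = ∑ i, WW n f t y i ^ 2 := fun y => rfl
  have hw1i : Integrable (fun y => w1g n (shift n f t y)) (gauss n) := by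
    simp_rw [hw1]
    refine integrable_finsetSum _ fun i _ => ?_
    refine Integrable.of_bound ((hWm i).pow_const 2).aestronglyMeasurable
      ((∫ x, |x i| ∂(gauss n)) ^ 2) (ae_of_all _ fun y => ?_)
    rw [norm_pow, Real.norm_eq_abs]
    exact pow_le_pow_left₀ (abs_nonneg _) (WW_bd hf h01 t y i) 2
  refine ⟨?_, hw1i⟩
  set G : (Fin n → ℝ) × (Fin n → ℝ) → ℝ := fun p => ∑ i, p.2 i * (ρ * WW n f t p.1 i) with hG
  have hGm : Measurable G := by
    refine Finset.measurable_sum _ fun i _ => ?_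
    exact (by fun_prop : Measurable fun p : (Fin n → ℝ) × (Fin n → ℝ) => p.2 i).mul
      (((hWm i).comp measurable_fst).const_mul ρ)
  have hG2m : Measurable fun p => G p ^ 2 := hGm.pow_const 2
  have hin : ∀ y, ∫ v, G (y, v) ^ 2 ∂(gauss n) = ρ ^ 2 * w1g n (shift n f t y) := fun y => by
    simp only [hG]
    rw [lin_sq, hw1, Finset.mul_sum]
    exact Finset.sum_congr rfl fun i _ => by ring
  have hG2i : Integrable (fun p => G p ^ 2) ((gauss n).prod (gauss n)) := by
    rw [integrable_prod_iff hG2m.aestronglyMeasurable]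
    refine ⟨ae_of_all _ fun y => (lin_memLp n (fun i => ρ * WW n f t y i)).integrable_sq, ?_⟩
    have : (fun y => ∫ v, ‖G (y, v) ^ 2‖ ∂(gauss n)) = fun y => ρ ^ 2 * w1g n (shift n f t y) := by
      ext y
      rw [← hin y]
      exact integral_congr_ae (ae_of_all _ fun v => by simp)
    rw [this]
    exact hw1i.const_mul _
  have hG2 : ∫ p, G p ^ 2 ∂((gauss n).prod (gauss n)) =
      ρ ^ 2 * ∫ y, w1g n (shift n f t y) ∂(gauss n) := by
    rw [integral_prod _ hG2i, ← integral_const_mul]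
    exact integral_congr_ae (ae_of_all _ hin)
  set R : ℝ → (Fin n → ℝ) × (Fin n → ℝ) → (Fin n → ℝ) × (Fin n → ℝ) :=
    fun θ p => ContinuousLinearMap.rotation (E := Fin n → ℝ) θ p with hR
  have hRe : ∀ θ p, R θ p = (Real.cos θ • p.1 + Real.sin θ • p.2, -Real.sin θ • p.1 + Real.cos θ • p.2) :=
    fun θ p => rfl
  have hRm : Measurable fun q : ℝ × ((Fin n → ℝ) × (Fin n → ℝ)) => R q.1 q.2 := by
    simp only [hRe]
    fun_prop
  have hrot : ∀ θ, ∫ p, G (R θ p) ^ 2 ∂((gauss n).prod (gauss n)) =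
      ∫ p, G p ^ 2 ∂((gauss n).prod (gauss n)) := fun θ => by
    have h := rot_inv n θ
    conv_rhs => rw [← h.map_eq]
    rw [integral_map h.measurable.aemeasurable hG2m.aestronglyMeasurable]
  have hroti : ∀ θ, Integrable (fun p => G (R θ p) ^ 2) ((gauss n).prod (gauss n)) := fun θ =>
    (rot_inv n θ).integrable_comp_of_integrable hG2i
  set ν : Measure ℝ := volume.restrict (Set.Ioc 0 (π / 2)) with hν
  have hνr : ν.real Set.univ = π / 2 := by
    simp [hν, Real.volume_real_Ioc, hpi.le]
  have hjm : Measurable fun q : ℝ × ((Fin n → ℝ) × (Fin n → ℝ)) => G (R q.1 q.2) ^ 2 := hG2m.comp hRm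
  have hji : Integrable (fun q : ℝ × ((Fin n → ℝ) × (Fin n → ℝ)) => G (R q.1 q.2) ^ 2)
      (ν.prod ((gauss n).prod (gauss n))) := by
    rw [integrable_prod_iff hjm.aestronglyMeasurable]
    refine ⟨ae_of_all _ fun θ => hroti θ, ?_⟩
    have : (fun θ => ∫ p, ‖G (R θ p) ^ 2‖ ∂((gauss n).prod (gauss n))) =
        fun _ => ∫ p, G p ^ 2 ∂((gauss n).prod (gauss n)) := by
      ext θ
      rw [← hrot θ]
      exact integral_congr_ae (ae_of_all _ fun v => by simp)
    simp only [this]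
    exact integrable_const _
  have hpt : ∀ p : (Fin n → ℝ) × (Fin n → ℝ),
      (F p.2 - F p.1) ^ 2 ≤ (π / 2) * ∫ θ, G (R θ p) ^ 2 ∂ν := fun p => by
    have hRp : Measurable fun θ => R θ p := by
      simp only [hRe]
      fun_prop
    have hD : Measurable fun θ => G (R θ p) := Measurable.comp (g := G) hGm hRp
    have hbd : ∀ θ, |G (R θ p)| ≤ ∑ i, (|p.1 i| + |p.2 i|) * (|ρ| * ∫ x, |x i| ∂(gauss n)) := fun θ => by
      simp only [hG]
      refine (Finset.abs_sum_le_sum_abs _ _).trans (Finset.sum_le_sum fun i _ => ?_)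
      rw [abs_mul, abs_mul]
      refine mul_le_mul ?_ (mul_le_mul_of_nonneg_left (WW_bd hf h01 t _ i) (abs_nonneg _))
        (by positivity) (by positivity)
      simp only [hRe, Pi.add_apply, Pi.smul_apply, smul_eq_mul]
      refine (abs_add_le _ _).trans (add_le_add ?_ ?_)
      · rw [abs_mul, abs_neg]; exact mul_le_of_le_one_left (abs_nonneg _) (Real.abs_sin_le_one _)
      · rw [abs_mul]; exact mul_le_of_le_one_left (abs_nonneg _) (Real.abs_cos_le_one _)
    have hDi : Integrable (fun θ => G (R θ p)) ν :=
      Integrable.of_bound hD.aestronglyMeasurable _ (ae_of_all _ hbd)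
    have hD2i : Integrable (fun θ => G (R θ p) ^ 2) ν :=
      Integrable.of_bound (hD.pow_const 2).aestronglyMeasurable
        ((∑ i, (|p.1 i| + |p.2 i|) * (|ρ| * ∫ x, |x i| ∂(gauss n))) ^ 2) (ae_of_all _ fun θ => by
          rw [norm_pow, Real.norm_eq_abs]
          exact pow_le_pow_left₀ (abs_nonneg _) (hbd θ) 2)
    have hftc := intervalIntegral.integral_eq_sub_of_hasDerivAt (a := 0) (b := π / 2)
      (f := fun θ => F (Real.cos θ • p.1 + Real.sin θ • p.2)) (f' := fun θ => G (R θ p))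
      (fun θ _ => path_deriv hf h01 t ht p.1 p.2 θ)
      ((intervalIntegrable_iff_integrableOn_Ioc_of_le hpi.le).2 hDi)
    rw [intervalIntegral.integral_of_le hpi.le] at hftc
    simp only [Real.cos_pi_div_two, Real.sin_pi_div_two, Real.cos_zero, Real.sin_zero, zero_smul,
      one_smul, zero_add, add_zero] at hftc
    rw [← hftc]
    exact cs_lem ν _ hpi hνr _ hDi hD2i
  rw [← two_var houm hou01]
  have hsw : ∫ p, ∫ θ, G (R θ p) ^ 2 ∂ν ∂((gauss n).prod (gauss n)) =
      (π / 2) * (ρ ^ 2 * ∫ y, w1g n (shift n f t y) ∂(gauss n)) := by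
    rw [← integral_integral_swap (f := fun θ p => G (R θ p) ^ 2) hji]
    simp_rw [hrot, hG2]
    rw [integral_const, hνr, smul_eq_mul]
  rw [← hsw, ← integral_const_mul]
  refine integral_mono_of_nonneg (ae_of_all _ fun p => sq_nonneg _)
    (hji.integral_prod_right.const_mul _) (ae_of_all _ hpt)

theorem stmt0 : ∃ c : ℝ, 0 < c ∧ ∀ (n : ℕ) (f : (Fin n → ℝ) → ℝ) (t : ℝ),
    Measurable f → (∀ x, f x ∈ Set.Icc (0:ℝ) 1) → 0 < t →
    gExp n (fun y => Mg n (shift n f t y)) ≥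
      c * (Real.exp (2*t) - 1) * gVar n (ou n t f) := by
  refine ⟨1 / 16, by norm_num, fun n f t hf h01 ht => ?_⟩
  obtain ⟨h1, hi⟩ := poinc hf h01 t ht
  have h2 : ∫ y, w1g n (shift n f t y) ∂(gauss n) ≤ 8 * gExp n (fun y => Mg n (shift n f t y)) := by
    unfold gExp
    rw [← integral_const_mul]
    exact integral_mono hi ((M_int hf h01 t).const_mul 8) fun y =>
      w1_le_M (shift_meas hf t y) fun x => h01 _
  set w := ∫ y, w1g n (shift n f t y) ∂(gauss n) with hw
  have hw0 : 0 ≤ w := integral_nonneg fun y => Finset.sum_nonneg fun i _ => sq_nonneg _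
  have hE : 0 < Real.exp (2*t) - 1 := by
    have := Real.one_lt_exp_iff.2 (show 0 < 2 * t by linarith); linarith
  have hρ : (Real.exp (-t) / Real.sqrt (1 - Real.exp (-2*t))) ^ 2 * (Real.exp (2*t) - 1) = 1 := by
    have h0 : 0 < 1 - Real.exp (-2*t) := by
      have : Real.exp (-2*t) < 1 := Real.exp_lt_one_iff.2 (by linarith)
      linarith
    rw [div_pow, Real.sq_sqrt h0.le, ← Real.exp_nat_mul, div_mul_eq_mul_div, div_eq_one_iff_eq h0.ne',
      mul_sub, ← Real.exp_add]
    push_cast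
    rw [show 2 * -t + 2 * t = 0 by ring, Real.exp_zero, show 2 * -t = -2 * t by ring]; ring
  set ρ2 := (Real.exp (-t) / Real.sqrt (1 - Real.exp (-2*t))) ^ 2 with hρ2
  have h3 := mul_le_mul_of_nonneg_right h1 hE.le
  have h4 : (π / 2) * ((π / 2) * (ρ2 * w)) * (Real.exp (2*t) - 1) = (π / 2) ^ 2 * w := by
    calc _ = (π / 2) ^ 2 * w * (ρ2 * (Real.exp (2*t) - 1)) := by ring
      _ = _ := by rw [hρ, mul_one]
  rw [h4] at h3
  have h5 : (π / 2) ^ 2 ≤ 4 := by nlinarith [Real.pi_pos, Real.pi_le_four]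
  nlinarith
end

section
/- Let B_n ⊂ ℝ^n be the Euclidean ball of radius √n centered at the origin. Then for every fixed t > 0, liminf_{n→∞} Var(P_t 1_{B_n}) ≥ 1/4 − arccos(e^{−2t})/(√2 · π). In particular the sequence (B_n) is noise stable. -/
open MeasureTheory Real

section A
open ProbabilityTheory

lemma gr_mom : (∫ x, x ∂(gaussianReal 0 1) = 0) ∧ (∫ x, x^2 ∂(gaussianReal 0 1) = 1) ∧
    (∫ x, x^3 ∂(gaussianReal 0 1) = 0) ∧ (∫ x, x^4 ∂(gaussianReal 0 1) = 3) := by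
  have key : ∀ n : ℕ, iteratedDeriv n (mgf id (gaussianReal 0 1)) 0
      = ∫ x, x^n ∂(gaussianReal 0 1) := by
    intro n
    rw [iteratedDeriv_mgf_zero (by simp)]
    rfl
  have h0 : mgf id (gaussianReal 0 1) = fun t => rexp (t^2/2) := by
    rw [mgf_id_gaussianReal]; ext t; simp
  have hd : ∀ t : ℝ, HasDerivAt (fun t => rexp (t^2/2)) (t * rexp (t^2/2)) t := by
    intro t
    have : HasDerivAt (fun t : ℝ => t^2/2) t t := by
      have := (hasDerivAt_pow 2 t).div_const 2
      convert! this using 1; simp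
    convert! this.exp using 1; ring
  have d1 : iteratedDeriv 1 (mgf id (gaussianReal 0 1)) = fun t => t * rexp (t^2/2) := by
    rw [iteratedDeriv_one, h0]; ext t; exact (hd t).deriv
  have d2 : iteratedDeriv 2 (mgf id (gaussianReal 0 1)) = fun t => (1 + t^2) * rexp (t^2/2) := by
    rw [iteratedDeriv_succ, d1]; ext t
    have := ((hasDerivAt_id' t).mul (hd t)).deriv
    simp only [Pi.mul_def] at this
    rw [this]; ring
  have d3 : iteratedDeriv 3 (mgf id (gaussianReal 0 1)) = fun t => (3*t + t^3) * rexp (t^2/2) := by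
    rw [iteratedDeriv_succ, d2]; ext t
    have := (((hasDerivAt_pow 2 t).const_add 1).mul (hd t)).deriv
    simp only [Pi.mul_def] at this
    rw [this]; norm_num; ring
  have d4 : iteratedDeriv 4 (mgf id (gaussianReal 0 1)) =
      fun t => (3 + 6*t^2 + t^4) * rexp (t^2/2) := by
    rw [iteratedDeriv_succ, d3]; ext t
    have := ((((hasDerivAt_id' t).const_mul 3).add (hasDerivAt_pow 3 t)).mul (hd t)).deriv
    simp only [Pi.mul_def, Pi.add_def] at this
    rw [this]; norm_num; ring
  refine ⟨?_, ?_, ?_, ?_⟩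
  · have := key 1; rw [d1] at this; simp
  · have := key 2; rw [d2] at this; simpa using this.symm
  · have := key 3; rw [d3] at this; simpa using this.symm
  · have := key 4; rw [d4] at this; simpa using this.symm

lemma gr_int_pow (k : ℕ) : Integrable (fun x : ℝ => x^k) (gaussianReal 0 1) := by
  have := memLp_id_gaussianReal (μ := 0) (v := 1) k
  refine (integrable_norm_iff (by fun_prop)).1 ?_
  simpa using MemLp.integrable_norm_pow' this

lemma gr_quartic (a0 a1 a2 a3 a4 : ℝ) :
    ∫ x, (a0 + a1*x + a2*x^2 + a3*x^3 + a4*x^4) ∂(gaussianReal 0 1) = a0 + a2 + 3*a4 := by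
  obtain ⟨h1, h2, h3, h4⟩ := gr_mom
  have i1 : Integrable (fun x : ℝ => a1*x) (gaussianReal 0 1) := by
    simpa using (gr_int_pow 1).const_mul a1
  have i2 := (gr_int_pow 2).const_mul a2
  have i3 := (gr_int_pow 3).const_mul a3
  have i4 := (gr_int_pow 4).const_mul a4
  have i0 : Integrable (fun x : ℝ => a0) (gaussianReal 0 1) := integrable_const _
  have j1 : Integrable (fun x : ℝ => a0 + a1*x) (gaussianReal 0 1) := i0.add i1
  have j2 : Integrable (fun x : ℝ => a0 + a1*x + a2*x^2) (gaussianReal 0 1) := j1.add i2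
  have j3 : Integrable (fun x : ℝ => a0 + a1*x + a2*x^2 + a3*x^3) (gaussianReal 0 1) := j2.add i3
  rw [integral_add j3 i4, integral_add j2 i3, integral_add j1 i2, integral_add i0 i1]
  rw [integral_const_mul, integral_const_mul, integral_const_mul, integral_const_mul, h1, h2, h3, h4]
  simp; ring

noncomputable def tau : Measure (ℝ × ℝ × ℝ) :=
  (gaussianReal 0 1).prod ((gaussianReal 0 1).prod (gaussianReal 0 1))

instance : IsProbabilityMeasure tau := by unfold tau; infer_instance

lemma tau_integral (f : ℝ × ℝ × ℝ → ℝ) (hf : Integrable f tau) :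
    ∫ p, f p ∂tau = ∫ x, ∫ y, ∫ z, f (x, y, z) ∂(gaussianReal 0 1) ∂(gaussianReal 0 1)
      ∂(gaussianReal 0 1) := by
  unfold tau at *
  rw [integral_prod _ hf]
  apply integral_congr_ae
  filter_upwards [hf.prod_right_ae] with x hx
  rw [integral_prod _ hx]

lemma tau_memLp_aux (c s : ℝ) :
    MemLp (fun p : ℝ × ℝ × ℝ => (c * p.1 + s * p.2.1)^2 - 1) 2 tau ∧
    MemLp (fun p : ℝ × ℝ × ℝ => (c * p.1 + s * p.2.2)^2 - 1) 2 tau := by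
  have h := memLp_id_gaussianReal' (μ := 0) (v := 1) 4 (by simp)
  have m1 : MemLp (fun p : ℝ × ℝ × ℝ => p.1) 4 tau :=
    h.comp_measurePreserving measurePreserving_fst
  have m2 : MemLp (fun p : ℝ × ℝ × ℝ => p.2.1) 4 tau :=
    h.comp_measurePreserving (measurePreserving_fst.comp measurePreserving_snd)
  have m3 : MemLp (fun p : ℝ × ℝ × ℝ => p.2.2) 4 tau :=
    h.comp_measurePreserving (measurePreserving_snd.comp measurePreserving_snd)
  have : ENNReal.HolderTriple 4 4 2 := ⟨by
    rw [← two_mul, show (4:ENNReal) = 2 * 2 by norm_num, ENNReal.mul_inv (by simp) (by simp),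
      ← mul_assoc, ENNReal.mul_inv_cancel (by simp) (by simp), one_mul]⟩
  have q : ∀ f : ℝ × ℝ × ℝ → ℝ, MemLp f 4 tau → MemLp (fun p => f p ^2 - 1) 2 tau := by
    intro f hf
    have h2 : MemLp (fun p => f p * f p) 2 tau := hf.mul hf
    have := h2.sub (memLp_const (1:ℝ))
    convert! this using 2
    rw [pow_two]; rfl
  exact ⟨q _ ((m1.const_mul c).add (m2.const_mul s)), q _ ((m1.const_mul c).add (m3.const_mul s))⟩

lemma tau_mean (c s a b : ℝ) (hcs : c^2 + s^2 = 1) :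
    ∫ p : ℝ × ℝ × ℝ, (a * ((c * p.1 + s * p.2.1)^2 - 1) + b * ((c * p.1 + s * p.2.2)^2 - 1)) ∂tau
      = 0 := by
  obtain ⟨h1, h2⟩ := tau_memLp_aux c s
  have hi : Integrable (fun p : ℝ × ℝ × ℝ => a * ((c * p.1 + s * p.2.1)^2 - 1) +
      b * ((c * p.1 + s * p.2.2)^2 - 1)) tau :=
    ((h1.const_mul a).add (h2.const_mul b)).integrable (by norm_num)
  rw [tau_integral _ hi]
  have e1 : ∀ x y : ℝ, ∫ z, (a * ((c * x + s * y)^2 - 1) + b * ((c * x + s * z)^2 - 1))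
      ∂(gaussianReal 0 1) = a * ((c * x + s * y)^2 - 1) + b * (c^2*x^2 - 1) + b * s^2 := by
    intro x y
    refine Eq.trans ?_ ((gr_quartic (a * ((c * x + s * y)^2 - 1) + b * (c^2*x^2 - 1))
      (2*b*c*s*x) (b*s^2) 0 0).trans (by ring))
    congr 1; ext z; ring
  have e2 : ∀ x : ℝ, ∫ y, (a * ((c * x + s * y)^2 - 1) + b * (c^2*x^2 - 1) + b * s^2)
      ∂(gaussianReal 0 1) = (a+b) * (c^2*x^2 - 1) + (a+b) * s^2 := by
    intro x
    refine Eq.trans ?_ ((gr_quartic ((a+b) * (c^2*x^2 - 1) + b * s^2) (2*a*c*s*x) (a*s^2) 0 0).trans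
      (by ring))
    congr 1; ext z; ring
  simp only [e1, e2]
  have := gr_quartic (-(a+b) + (a+b)*s^2) 0 ((a+b)*c^2) 0 0
  rw [show -(a+b) + (a+b)*s^2 + (a+b)*c^2 + 3 * 0 = 0 by linear_combination (a+b)*hcs] at this
  refine Eq.trans ?_ this
  congr 1; ext z; ring

lemma tau_var (c s a b : ℝ) (hcs : c^2 + s^2 = 1) :
    ∫ p : ℝ × ℝ × ℝ, (a * ((c * p.1 + s * p.2.1)^2 - 1) + b * ((c * p.1 + s * p.2.2)^2 - 1))^2 ∂tau
      = 2 * (a^2 + b^2 + 2 * c^4 * (a * b)) := by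
  obtain ⟨h1, h2⟩ := tau_memLp_aux c s
  have hi : Integrable (fun p : ℝ × ℝ × ℝ => (a * ((c * p.1 + s * p.2.1)^2 - 1) +
      b * ((c * p.1 + s * p.2.2)^2 - 1))^2) tau :=
    ((h1.const_mul a).add (h2.const_mul b)).integrable_sq
  rw [tau_integral _ hi]
  have e1 : ∀ x y : ℝ, ∫ z, (a * ((c * x + s * y)^2 - 1) + b * ((c * x + s * z)^2 - 1))^2
      ∂(gaussianReal 0 1) = (a * ((c * x + s * y)^2 - 1) + b * (c^2*x^2 - 1))^2
        + (b^2*4*c^2*s^2*x^2 + 2*(a * ((c * x + s * y)^2 - 1) + b * (c^2*x^2 - 1))*b*s^2)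
        + 3 * (b^2*s^4) := by
    intro x y
    rw [← gr_quartic _ (4*(a * ((c * x + s * y)^2 - 1) + b * (c^2*x^2 - 1))*b*c*s*x) _
      (4*b^2*c*s^3*x) _]
    congr 1; ext z; ring
  have e2 : ∀ x : ℝ, ∫ y, ((a * ((c * x + s * y)^2 - 1) + b * (c^2*x^2 - 1))^2
        + (b^2*4*c^2*s^2*x^2 + 2*(a * ((c * x + s * y)^2 - 1) + b * (c^2*x^2 - 1))*b*s^2)
        + 3 * (b^2*s^4))
      ∂(gaussianReal 0 1) =
        (((a+b) * (c^2*x^2 - 1))^2 + b^2*4*c^2*s^2*x^2 + 2*((a+b) * (c^2*x^2 - 1))*b*s^2 + 3*b^2*s^4)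
        + (a^2*4*c^2*s^2*x^2 + 2*((a+b) * (c^2*x^2 - 1))*a*s^2 + 2*a*b*s^4) + 3 * (a^2*s^4) := by
    intro x
    rw [← gr_quartic _ (4*((a+b) * (c^2*x^2 - 1))*a*c*s*x + 4*a*b*c*s^3*x) _
      (4*a^2*c*s^3*x) _]
    congr 1; ext z; ring
  simp only [e1, e2]
  have := gr_quartic ((a+b)^2 - 2*(a+b)^2*s^2 + 3*b^2*s^4+2*a*b*s^4+3*(a^2*s^4)) 0
    (-2*(a+b)^2*c^2 + 4*(a^2+b^2)*c^2*s^2 + 2*(a+b)^2*c^2*s^2) 0 ((a+b)^2*c^4)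
  have hs : s^2 = 1 - c^2 := by linarith
  have hs4 : s^4 = (1 - c^2)^2 := by rw [← hs]; ring
  trans (((a+b)^2 - 2*(a+b)^2*s^2 + 3*b^2*s^4+2*a*b*s^4+3*(a^2*s^4)) +
    (-2*(a+b)^2*c^2 + 4*(a^2+b^2)*c^2*s^2 + 2*(a+b)^2*c^2*s^2) + 3 * ((a+b)^2*c^4))
  · rw [← this]
    congr 1; ext z; ring
  · rw [hs4, hs]; ring
end A

section B
open ProbabilityTheory Filter Topology

lemma charFun_sum_pi {T : Type*} [MeasurableSpace T] (τ : Measure T) [IsProbabilityMeasure τ]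
    {E : Type*} [NormedAddCommGroup E] [InnerProductSpace ℝ E]
    [MeasurableSpace E] [BorelSpace E] [SecondCountableTopology E]
    (W : T → E) (hW : Measurable W) (n : ℕ) (u : E) :
    charFun ((Measure.pi (fun _ : Fin n => τ)).map (fun w => (√n)⁻¹ • ∑ i, W (w i))) u =
      (charFun (τ.map (fun w => inner ℝ (W w) u)) ((√n)⁻¹ * 1)) ^ n := by
  rw [charFun_map_smul_comp (f := fun w : Fin n → T => ∑ i, W (w i))
    (by have := hW; exact (Measurable.aemeasurable (by fun_prop))) _ _]
  have hi : iIndepFun (fun (i : Fin n) (w : Fin n → T) => W (w i)) (Measure.pi (fun _ : Fin n => τ)) :=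
    iIndepFun_pi (X := fun _ => W) (fun _ => hW.aemeasurable)
  rw [hi.charFun_map_fun_sum_eq_prod (fun i => Measurable.aemeasurable (by fun_prop))]
  have : ∀ i : Fin n, (Measure.pi (fun _ : Fin n => τ)).map (fun w => W (w i)) = τ.map W := by
    intro i
    have h := (measurePreserving_eval (fun _ : Fin n => τ) i)
    conv_rhs => rw [← h.map_eq, Measure.map_map hW h.measurable]
    rfl
  simp only [this, Finset.prod_const, Finset.card_univ, Fintype.card_fin, Finset.prod_apply]
  congr 1
  rw [charFun_apply, charFun_apply, integral_map (by fun_prop) (by fun_prop),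
    integral_map (by fun_prop) (by fun_prop)]
  congr 1; ext w
  simp [inner_smul_right]

lemma clt2 {T : Type*} [MeasurableSpace T] (τ : Measure T) [IsProbabilityMeasure τ]
    {E : Type*} [NormedAddCommGroup E] [InnerProductSpace ℝ E] [FiniteDimensional ℝ E]
    [MeasurableSpace E] [BorelSpace E] [SecondCountableTopology E]
    (W : T → E) (hW : Measurable W) (v : E → ℝ) (hv : ∀ u, u ≠ 0 → 0 < v u)
    (h0 : ∀ u, ∫ w, inner ℝ (W w) u ∂τ = 0) (h1 : ∀ u, ∫ w, (inner ℝ (W w) u)^2 ∂τ = v u)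
    (u : E) :
    Tendsto (fun n : ℕ => charFun ((Measure.pi (fun _ : Fin n => τ)).map
      (fun w => (√n)⁻¹ • ∑ i, W (w i))) u) atTop (𝓝 (Complex.exp (-(v u)/2))) := by
  simp only [charFun_sum_pi τ W hW]
  by_cases hu : u = 0
  · subst hu
    have := h1 0
    simp only [inner_zero_right] at this ⊢
    simp only [ne_eq, OfNat.ofNat_ne_zero, not_false_eq_true, zero_pow, integral_zero] at this
    simp [← this, charFun_dirac]
  · have hp := hv u hu
    set σ := √(v u) with hσ
    have hσp : 0 < σ := Real.sqrt_pos.2 hp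
    have hσ2 : σ^2 = v u := Real.sq_sqrt hp.le
    have key := tendsto_charFun_inv_sqrt_mul_pow (P := τ)
      (X := fun w => σ⁻¹ * inner ℝ (W w) u) (by fun_prop)
      (by rw [integral_const_mul, h0, mul_zero])
      (by simp only [Pi.pow_apply, mul_pow]; rw [integral_const_mul, h1, ← hσ2]; field_simp) σ
    have e : ∀ n : ℕ, charFun (τ.map (fun w => σ⁻¹ * inner ℝ (W w) u)) ((√n)⁻¹ * σ) =
      charFun (τ.map (fun w => inner ℝ (W w) u)) ((√n)⁻¹ * 1) := by
      intro n
      rw [charFun_map_mul_comp (by fun_prop)]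
      congr 1; field_simp
    simp only [e] at key
    convert! key using 3
    rw [← hσ2]; push_cast; ring

noncomputable def nuMap (κ l : ℝ) (p : ℝ × ℝ) : EuclideanSpace ℝ (Fin 2) :=
  !₂[√2 * p.1, √2 * (κ * p.1 + l * p.2)]

lemma nuMap_meas (κ l : ℝ) : Measurable (nuMap κ l) := by
  unfold nuMap
  apply (WithLp.measurable_toLp 2 _).comp
  apply measurable_pi_iff.2
  intro i
  fin_cases i <;> simp <;> fun_prop

noncomputable def nu (κ l : ℝ) : Measure (EuclideanSpace ℝ (Fin 2)) :=
  ((gaussianReal 0 1).prod (gaussianReal 0 1)).map (nuMap κ l)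

instance (κ l : ℝ) : IsProbabilityMeasure (nu κ l) :=
  Measure.isProbabilityMeasure_map (nuMap_meas κ l).aemeasurable

lemma nu_charFun (κ l : ℝ) (hkl : κ^2 + l^2 = 1) (u : EuclideanSpace ℝ (Fin 2)) :
    charFun (nu κ l) u =
      Complex.exp (-((2 * (u 0 ^2 + u 1 ^2 + 2 * κ * (u 0 * u 1)) : ℝ) : ℂ)/2) := by
  unfold nu
  rw [charFun_apply, integral_map (nuMap_meas κ l).aemeasurable (by fun_prop)]
  have e : ∀ p : ℝ × ℝ, Complex.exp ((inner ℝ (nuMap κ l p) u : ℝ) * Complex.I) =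
      Complex.exp (((√2 * (u 0 + κ * u 1) : ℝ):ℂ) * p.1 * Complex.I) *
      Complex.exp (((√2 * (l * u 1) : ℝ):ℂ) * p.2 * Complex.I) := by
    intro p
    rw [← Complex.exp_add]
    congr 1
    simp [nuMap, PiLp.inner_apply, Fin.sum_univ_two]
    ring
  simp only [e]
  have := integral_prod_mul (μ := gaussianReal 0 1) (ν := gaussianReal 0 1)
    (fun x : ℝ => Complex.exp (((√2 * (u 0 + κ * u 1) : ℝ):ℂ) * x * Complex.I))
    (fun x : ℝ => Complex.exp (((√2 * (l * u 1) : ℝ):ℂ) * x * Complex.I))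
  rw [this, ← charFun_apply_real, ← charFun_apply_real, charFun_gaussianReal, charFun_gaussianReal,
    ← Complex.exp_add]
  congr 1
  have h2 : (√2:ℝ)^2 = 2 := Real.sq_sqrt (by norm_num)
  have : ((√2 * (u 0 + κ * u 1))^2/2 + (√2 * (l * u 1))^2/2) =
    (2 * (u 0 ^2 + u 1 ^2 + 2 * κ * (u 0 * u 1)))/2 := by
    simp only [mul_pow, h2]
    linear_combination (u 1)^2 * hkl
  have h := congrArg (fun x : ℝ => -(x:ℂ)) this
  simp only at h
  push_cast at h ⊢
  linear_combination h

lemma gr_half : gaussianReal 0 1 (Set.Iic 0) = 1/2 := by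
  have : NullMeasurableSet (Set.Iic (0:ℝ)) (gaussianReal 0 1) := measurableSet_Iic.nullMeasurableSet
  have h1 : gaussianReal 0 1 (Set.Iic 0) = gaussianReal 0 1 (Set.Ici 0) := by
    have := gaussianReal_map_neg (μ := 0) (v := 1)
    conv_lhs => rw [← neg_zero, ← this]
    rw [Measure.map_apply (by fun_prop) measurableSet_Iic]
    simp
  have := nullSingletonClass_gaussianReal (μ := 0) (v := 1) (by simp)
  have h2 : gaussianReal 0 1 (Set.Iic 0) + gaussianReal 0 1 (Set.Ici 0) = 1 := by
    rw [← Ioi_ae_eq_Ici.measure_eq, ← Set.compl_Iic]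
    exact prob_add_prob_compl measurableSet_Iic
  rw [← h1, ← two_mul] at h2
  rw [one_div]
  exact ENNReal.eq_inv_of_mul_eq_one_left (by rwa [mul_comm])

lemma nu_closed (κ l : ℝ) : nu κ l {v | v 0 ≤ 0} = 1/2 := by
  unfold nu
  rw [Measure.map_apply (nuMap_meas κ l) (measurableSet_le (by fun_prop) (by fun_prop))]
  have : nuMap κ l ⁻¹' {v | v 0 ≤ 0} = Prod.fst ⁻¹' (Set.Iic 0) := by
    ext p
    simp only [nuMap, Set.mem_preimage, Set.mem_ofPred_eq, Set.mem_Iic]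
    show √2 * p.1 ≤ 0 ↔ _
    constructor
    · intro h; by_contra hh; push Not at hh
      have : 0 < √2 * p.1 := by positivity
      linarith
    · intro h; exact mul_nonpos_of_nonneg_of_nonpos (by positivity) h
  rw [this, (measurePreserving_fst).measure_preimage measurableSet_Iic.nullMeasurableSet, gr_half]
end B

section C
open ProbabilityTheory Filter Topology

lemma trig_ineq (θ : ℝ) (h0 : 0 ≤ θ) (h1 : θ ≤ π/2) : cos (√2 * θ) ≤ cos θ ^ 2 := by
  have s2 : (√2:ℝ)^2 = 2 := Real.sq_sqrt (by norm_num)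
  have s2p : 0 < (√2:ℝ) := by positivity
  have hd : ∀ x : ℝ, HasDerivAt (fun x => cos x ^2 - cos (√2 * x))
      (√2 * sin (√2 * x) - sin (2 * x)) x := by
    intro x
    have a := (Real.hasDerivAt_cos x).pow 2
    have b := (((hasDerivAt_id' x).const_mul (√2)).cos)
    convert! a.sub b using 1
    rw [Real.sin_two_mul]; simp; ring
  have hm : MonotoneOn (fun x => cos x ^2 - cos (√2 * x)) (Set.Icc 0 (π/2)) := by
    apply monotoneOn_of_deriv_nonneg (convex_Icc _ _) (by fun_prop)
    · intro x _; exact (hd x).differentiableAt.differentiableWithinAt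
    · intro x hx
      rw [interior_Icc] at hx
      rw [(hd x).deriv]
      have hc := strictConcaveOn_sin_Icc.concaveOn.2 (show 2*x ∈ Set.Icc 0 π from
        ⟨by linarith [hx.1], by linarith [hx.2]⟩) (show (0:ℝ) ∈ Set.Icc 0 π from ⟨le_rfl, pi_pos.le⟩)
        (show 0 ≤ √2/2 by positivity) (show 0 ≤ 1 - √2/2 by nlinarith) (by ring)
      simp only [smul_eq_mul, sin_zero, mul_zero, add_zero] at hc
      rw [show √2/2 * (2*x) = √2 * x by ring] at hc
      have h3 := mul_le_mul_of_nonneg_left hc s2p.le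
      have h4 : √2 * (√2 / 2 * sin (2 * x)) = sin (2 * x) := by
        linear_combination (sin (2*x) / 2) * s2
      linarith
  have := hm ⟨le_rfl, by positivity⟩ ⟨h0, h1⟩ h0
  simp at this
  exact this

lemma arccos_ineq (ρ : ℝ) (h0 : 0 ≤ ρ) (h1 : ρ ≤ 1) : arccos (ρ^2) ≤ √2 * arccos ρ := by
  have hp : arccos ρ ≤ π/2 := Real.arccos_le_pi_div_two.2 h0
  have h := trig_ineq (arccos ρ) (arccos_nonneg _) hp
  rw [Real.cos_arccos (by linarith) h1] at h
  have := Real.arccos_le_arccos h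
  rwa [Real.arccos_cos (mul_nonneg (by positivity) (arccos_nonneg _))] at this
  have s2 : (√2:ℝ)^2 = 2 := Real.sq_sqrt (by norm_num)
  have s2p : 0 < (√2:ℝ) := by positivity
  have : √2 ≤ 2 := by nlinarith
  have := arccos_nonneg ρ
  nlinarith

lemma polar_formula (S : Set (ℝ × ℝ)) (hS : MeasurableSet S) :
    ((gaussianReal 0 1).prod (gaussianReal 0 1)) S =
      ∫⁻ p in Set.Ioi (0:ℝ) ×ˢ Set.Ioo (-π) π, ENNReal.ofReal p.1 *
        (S.indicator 1 (p.1 * cos p.2, p.1 * sin p.2) *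
          ENNReal.ofReal ((2*π)⁻¹ * rexp (-p.1^2/2))) := by
  rw [gaussianReal_of_var_ne_zero 0 (one_ne_zero),
    prod_withDensity (measurable_gaussianPDF _ _) (measurable_gaussianPDF _ _),
    withDensity_apply _ hS, ← lintegral_indicator hS, ← Measure.volume_eq_prod,
    ← lintegral_comp_polarCoord_symm]
  rw [polarCoord_target]
  apply lintegral_congr
  intro p
  rw [smul_eq_mul, polarCoord_symm_apply]
  congr 1
  by_cases h : (p.1 * cos p.2, p.1 * sin p.2) ∈ S
  · rw [Set.indicator_of_mem h, Set.indicator_of_mem h, gaussianPDF, gaussianPDF,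
      ← ENNReal.ofReal_mul (gaussianPDFReal_nonneg _ _ _)]
    simp only [Pi.one_apply, one_mul]
    congr 1
    simp only [gaussianPDFReal]
    have : (√(2*π))⁻¹ * (√(2*π))⁻¹ = (2*π)⁻¹ := by
      rw [← mul_inv, Real.mul_self_sqrt (by positivity)]
    simp only [NNReal.coe_one, mul_one, sub_zero]
    rw [mul_mul_mul_comm, this, ← Real.exp_add]
    congr 2
    have := Real.sin_sq_add_cos_sq p.2
    linear_combination (-p.1^2/2) * this
  · rw [Set.indicator_of_notMem h, Set.indicator_of_notMem h, zero_mul]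

lemma polar_lower (A : Set ℝ) (hA : MeasurableSet A) (hA' : A ⊆ Set.Ioo (-π) π)
    (S : Set (ℝ × ℝ)) (hS : MeasurableSet S)
    (h : ∀ r : ℝ, 0 < r → ∀ θ ∈ A, (r * cos θ, r * sin θ) ∈ S) :
    volume A / ENNReal.ofReal (2*π) ≤ ((gaussianReal 0 1).prod (gaussianReal 0 1)) S := by
  set I : ENNReal := ∫⁻ r in Set.Ioi (0:ℝ), ENNReal.ofReal r *
          ENNReal.ofReal ((2*π)⁻¹ * rexp (-r^2/2)) with hI
  have key : ∀ B : Set ℝ, MeasurableSet B → ∫⁻ p in Set.Ioi (0:ℝ) ×ˢ B, (ENNReal.ofReal p.1 *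
          ENNReal.ofReal ((2*π)⁻¹ * rexp (-p.1^2/2))) = I * volume B := by
    intro B hB
    rw [Measure.volume_eq_prod, ← Measure.prod_restrict]
    have := lintegral_prod_mul (μ := volume.restrict (Set.Ioi (0:ℝ))) (ν := volume.restrict B)
      (f := fun r => ENNReal.ofReal r * ENNReal.ofReal ((2*π)⁻¹ * rexp (-r^2/2)))
      (g := fun _ => 1) (by fun_prop) (by fun_prop)
    simpa [hI] using this
  have h1 : I * ENNReal.ofReal (2*π) = 1 := by
    have := polar_formula Set.univ MeasurableSet.univ
    rw [measure_univ] at this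
    simp only [Set.indicator_univ, Pi.one_apply, one_mul] at this
    rw [key _ measurableSet_Ioo, Real.volume_Ioo] at this
    rw [this]; congr 2; ring
  have h2 : I = (ENNReal.ofReal (2*π))⁻¹ := ENNReal.eq_inv_of_mul_eq_one_left h1
  rw [ENNReal.div_eq_inv_mul, ← h2, ← key A hA, polar_formula S hS]
  calc _ = ∫⁻ p in Set.Ioi (0:ℝ) ×ˢ A, ENNReal.ofReal p.1 *
        (S.indicator 1 (p.1 * cos p.2, p.1 * sin p.2) *
          ENNReal.ofReal ((2*π)⁻¹ * rexp (-p.1^2/2))) := by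
        apply setLIntegral_congr_fun (measurableSet_Ioi.prod hA)
        intro p hp
        simp only
        rw [Set.indicator_of_mem (h p.1 hp.1 p.2 hp.2)]; simp
    _ ≤ _ := lintegral_mono_set (Set.prod_mono le_rfl hA')

lemma sheppard (α : ℝ) (h0 : 0 ≤ α) (h1 : α ≤ π/2) :
    ENNReal.ofReal (1/2 - α/(2*π)) ≤ ((gaussianReal 0 1).prod (gaussianReal 0 1))
      {p | p.1 < 0 ∧ cos α * p.1 + sin α * p.2 < 0} := by
  have hpi := pi_pos
  have := polar_lower (Set.Ioo (-π) (-(π/2)) ∪ Set.Ioo (α + π/2) π)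
    (measurableSet_Ioo.union measurableSet_Ioo)
    (by
      rintro x (⟨h, h'⟩ | ⟨h, h'⟩) <;> constructor <;> linarith)
    {p | p.1 < 0 ∧ cos α * p.1 + sin α * p.2 < 0}
    (by
      have h1 : MeasurableSet {p : ℝ × ℝ | p.1 < 0} := measurableSet_lt (by fun_prop) (by fun_prop)
      have h2 : MeasurableSet {p : ℝ × ℝ | cos α * p.1 + sin α * p.2 < 0} :=
        measurableSet_lt (by fun_prop) (by fun_prop)
      convert! h1.inter h2 using 1)
    (by
      intro r hr θ hθ
      have e : cos α * (r * cos θ) + sin α * (r * sin θ) = r * cos (θ - α) := by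
        rw [cos_sub]; ring
      show r * cos θ < 0 ∧ cos α * (r * cos θ) + sin α * (r * sin θ) < 0
      rw [e]
      have : cos θ < 0 ∧ cos (θ - α) < 0 := by
        rcases hθ with ⟨h, h'⟩ | ⟨h, h'⟩
        · rw [← cos_neg θ, ← cos_neg (θ - α)]
          exact ⟨cos_neg_of_pi_div_two_lt_of_lt (by linarith) (by linarith),
            cos_neg_of_pi_div_two_lt_of_lt (by linarith) (by linarith)⟩
        · exact ⟨cos_neg_of_pi_div_two_lt_of_lt (by linarith) (by linarith),
            cos_neg_of_pi_div_two_lt_of_lt (by linarith) (by linarith)⟩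
      exact ⟨mul_neg_of_pos_of_neg hr this.1, mul_neg_of_pos_of_neg hr this.2⟩)
  refine le_trans (le_of_eq ?_) this
  rw [measure_union _ measurableSet_Ioo, Real.volume_Ioo, Real.volume_Ioo,
    ← ENNReal.ofReal_add (by linarith) (by linarith), ← ENNReal.ofReal_div_of_pos (by positivity)]
  · congr 1; field_simp; ring
  · rw [Set.disjoint_left]
    rintro x ⟨_, h⟩ ⟨h', _⟩
    linarith
end C

section D
open ProbabilityTheory Filter Topology

lemma triple_mp {T1 : Type*} [MeasurableSpace T1] (γ : Measure T1) [IsProbabilityMeasure γ] (n : ℕ) :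
    MeasurePreserving (fun w : Fin n → T1 × T1 × T1 =>
      ((fun i => (w i).1), (fun i => (w i).2.1), (fun i => (w i).2.2)))
      (Measure.pi fun _ => γ.prod (γ.prod γ))
      ((Measure.pi fun _ => γ).prod ((Measure.pi fun _ => γ).prod (Measure.pi fun _ => γ))) := by
  have h1 := measurePreserving_arrowProdEquivProdArrow T1 (T1 × T1) (Fin n) (fun _ => γ)
    (fun _ => γ.prod γ)
  have h2 := measurePreserving_arrowProdEquivProdArrow T1 T1 (Fin n) (fun _ => γ) (fun _ => γ)
  exact ((MeasurePreserving.id _).prod h2).comp h1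

lemma var_abs {X : Type*} [MeasurableSpace X] (G : Measure X) [IsProbabilityMeasure G]
    (F : X → X → ℝ) (hF : Measurable (fun p : X × X => F p.1 p.2))
    (hb : ∀ x y, ‖F x y‖ ≤ 1) :
    ∫ x, ((∫ y, F x y ∂G) - ∫ x', ∫ y, F x' y ∂G ∂G) * ((∫ y, F x y ∂G) - ∫ x', ∫ y, F x' y ∂G ∂G) ∂G
     = ∫ p, F p.1 p.2.1 * F p.1 p.2.2 ∂(G.prod (G.prod G)) -
      (∫ p, F p.1 p.2.1 ∂(G.prod (G.prod G)))^2 := by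
  have m1 : Measurable (fun p : X × X × X => F p.1 p.2.1) :=
    hF.comp (measurable_fst.prodMk (measurable_fst.comp measurable_snd))
  have m2 : Measurable (fun p : X × X × X => F p.1 p.2.2) :=
    hF.comp (measurable_fst.prodMk (measurable_snd.comp measurable_snd))
  have i1 : Integrable (fun p : X × X × X => F p.1 p.2.1) (G.prod (G.prod G)) :=
    Integrable.of_bound m1.aestronglyMeasurable 1 (Filter.Eventually.of_forall fun p => hb _ _)
  have i2 : Integrable (fun p : X × X × X => F p.1 p.2.1 * F p.1 p.2.2) (G.prod (G.prod G)) :=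
    Integrable.of_bound (m1.mul m2).aestronglyMeasurable 1 (Filter.Eventually.of_forall fun p => by
      rw [norm_mul]; exact mul_le_one₀ (hb _ _) (norm_nonneg _) (hb _ _))
  have e1 : ∀ x, ∫ q : X × X, F x q.1 ∂(G.prod G) = ∫ y, F x y ∂G := by
    intro x
    simpa using integral_prod_mul (μ := G) (ν := G) (fun y => F x y) (fun _ => (1:ℝ))
  have e2 : ∀ x, ∫ q : X × X, F x q.1 * F x q.2 ∂(G.prod G) = (∫ y, F x y ∂G)*(∫ y, F x y ∂G) := by
    intro x
    exact integral_prod_mul (μ := G) (ν := G) (fun y => F x y) (fun y => F x y)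
  have j1 := i1.integral_prod_left
  have j2 := i2.integral_prod_left
  rw [integral_prod _ i1, integral_prod _ i2]
  simp only [e1, e2] at j1 j2 ⊢
  set m := ∫ x, ∫ y, F x y ∂G ∂G
  have : ∀ x, ((∫ y, F x y ∂G) - m) * ((∫ y, F x y ∂G) - m) =
    (∫ y, F x y ∂G) * (∫ y, F x y ∂G) - (2*m) * (∫ y, F x y ∂G) + m^2 := by intro x; ring
  simp only [this]
  have j3 : Integrable (fun x => (∫ y, F x y ∂G) * (∫ y, F x y ∂G) - (2*m) * (∫ y, F x y ∂G)) G :=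
    j2.sub (j1.const_mul _)
  rw [integral_add j3 (integrable_const _), integral_sub j2 (j1.const_mul _), integral_const_mul]
  simp; ring
end D

section E
open ProbabilityTheory Filter Topology

noncomputable def Wv (c s : ℝ) (p : ℝ × ℝ × ℝ) : EuclideanSpace ℝ (Fin 2) :=
  !₂[(c * p.1 + s * p.2.1)^2 - 1, (c * p.1 + s * p.2.2)^2 - 1]

lemma Wv_meas (c s : ℝ) : Measurable (Wv c s) := by
  unfold Wv
  apply (WithLp.measurable_toLp 2 _).comp
  apply measurable_pi_iff.2
  intro i
  fin_cases i <;> simp <;> fun_prop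

lemma Wv_inner (c s : ℝ) (p : ℝ × ℝ × ℝ) (u : EuclideanSpace ℝ (Fin 2)) :
    inner ℝ (Wv c s p) u = u 0 * ((c * p.1 + s * p.2.1)^2 - 1) +
      u 1 * ((c * p.1 + s * p.2.2)^2 - 1) := by
  simp [Wv, PiLp.inner_apply, Fin.sum_univ_two]

noncomputable def law (c s : ℝ) (n : ℕ) : Measure (EuclideanSpace ℝ (Fin 2)) :=
  (Measure.pi (fun _ : Fin n => tau)).map (fun w => (√n)⁻¹ • ∑ i, Wv c s (w i))

lemma lawMap_meas (c s : ℝ) (n : ℕ) :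
    Measurable (fun w : Fin n → ℝ × ℝ × ℝ => (√n)⁻¹ • ∑ i, Wv c s (w i)) := by
  have := Wv_meas c s
  fun_prop

instance (c s : ℝ) (n : ℕ) : IsProbabilityMeasure (law c s n) :=
  Measure.isProbabilityMeasure_map (lawMap_meas c s n).aemeasurable

noncomputable def lawP (c s : ℝ) (n : ℕ) : ProbabilityMeasure (EuclideanSpace ℝ (Fin 2)) :=
  ⟨law c s n, inferInstance⟩

noncomputable def nuP (κ l : ℝ) : ProbabilityMeasure (EuclideanSpace ℝ (Fin 2)) :=
  ⟨nu κ l, inferInstance⟩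

lemma law_tendsto (c s l : ℝ) (hcs : c^2 + s^2 = 1) (hs : 0 < s) (hl : (c^4)^2 + l^2 = 1) :
    Tendsto (fun n => lawP c s n) atTop (𝓝 (nuP (c^4) l)) := by
  apply ProbabilityMeasure.tendsto_of_tendsto_charFun
  intro u
  show Tendsto (fun n => charFun (law c s n) u) atTop (𝓝 (charFun (nu (c^4) l) u))
  rw [nu_charFun _ _ hl]
  refine clt2 tau (Wv c s) (Wv_meas c s)
    (fun u => 2 * (u 0 ^2 + u 1 ^2 + 2 * c^4 * (u 0 * u 1))) ?_ ?_ ?_ u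
  · intro u hu
    have h1 : c^4 < 1 := by
      have : c^2 < 1 := by nlinarith
      have := sq_nonneg c
      nlinarith
    have h0 : 0 ≤ c^4 := by positivity
    have hne : 0 < u 0 ^2 + u 1 ^2 := by
      rcases (add_nonneg (sq_nonneg (u 0)) (sq_nonneg (u 1))).lt_or_eq with h | h
      · exact h
      · exfalso; apply hu
        ext i
        fin_cases i
        · show u 0 = 0
          nlinarith [sq_nonneg (u 0), sq_nonneg (u 1)]
        · show u 1 = 0
          nlinarith [sq_nonneg (u 0), sq_nonneg (u 1)]
    nlinarith [mul_nonneg h0 (sq_nonneg (u 0 + u 1)), mul_pos (sub_pos.2 h1) hne]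
  · intro u
    simp only [Wv_inner]
    exact tau_mean c s _ _ hcs
  · intro u
    simp only [Wv_inner]
    exact tau_var c s _ _ hcs

noncomputable def Ff (n : ℕ) (c s : ℝ) (x y : Fin n → ℝ) : ℝ :=
  Set.indicator {x : Fin n → ℝ | ∑ i, (x i) ^ 2 ≤ (n : ℝ)} 1 (fun i => c * x i + s * y i)

lemma Ff_meas (n : ℕ) (c s : ℝ) :
    Measurable (fun p : (Fin n → ℝ) × (Fin n → ℝ) => Ff n c s p.1 p.2) := by
  have hBm : MeasurableSet {x : Fin n → ℝ | ∑ i, (x i) ^ 2 ≤ (n : ℝ)} :=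
    measurableSet_le (by fun_prop) (by fun_prop)
  have h1 : Measurable (Set.indicator {x : Fin n → ℝ | ∑ i, (x i) ^ 2 ≤ (n : ℝ)}
    (1 : (Fin n → ℝ) → ℝ)) := measurable_one.indicator hBm
  exact h1.comp (by fun_prop)

lemma Ff_bound (n : ℕ) (c s : ℝ) (x y : Fin n → ℝ) : ‖Ff n c s x y‖ ≤ 1 := by
  unfold Ff
  refine (norm_indicator_le_norm_self _ _).trans (by simp)

lemma sum_scale (n : ℕ) (hn : 0 < n) (f : Fin n → ℝ) :
    (√n : ℝ)⁻¹ * ∑ i, ((f i)^2 - 1) ≤ 0 ↔ ∑ i, (f i)^2 ≤ (n:ℝ) := by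
  have hsq : 0 < (√n : ℝ)⁻¹ := by positivity
  rw [Finset.sum_sub_distrib]
  simp only [Finset.sum_const, Finset.card_univ, Fintype.card_fin, nsmul_eq_mul, mul_one]
  constructor
  · intro h; by_contra hh; push Not at hh
    have := mul_pos hsq (sub_pos.2 hh)
    linarith
  · intro h; exact mul_nonpos_of_nonneg_of_nonpos hsq.le (by linarith)

lemma Ff_eq0 (n : ℕ) (hn : 0 < n) (c s : ℝ) (w : Fin n → ℝ × ℝ × ℝ) :
    Ff n c s (fun i => (w i).1) (fun i => (w i).2.1) =
      Set.indicator {v : EuclideanSpace ℝ (Fin 2) | v 0 ≤ 0} (1 : EuclideanSpace ℝ (Fin 2) → ℝ)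
        ((√n)⁻¹ • ∑ i, Wv c s (w i)) := by
  have h : ((√n)⁻¹ • ∑ i, Wv c s (w i)) 0 ≤ 0 ↔ _ :=
    (by simp [Wv] : _ ↔ (√n : ℝ)⁻¹ * ∑ i, ((c * (w i).1 + s * (w i).2.1)^2 - 1) ≤ 0).trans
      (sum_scale n hn (fun i => c * (w i).1 + s * (w i).2.1))
  unfold Ff
  simp only [Set.indicator_apply, Set.mem_ofPred_eq, h, Pi.one_apply]

lemma Ff_eq1 (n : ℕ) (hn : 0 < n) (c s : ℝ) (w : Fin n → ℝ × ℝ × ℝ) :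
    Ff n c s (fun i => (w i).1) (fun i => (w i).2.2) =
      Set.indicator {v : EuclideanSpace ℝ (Fin 2) | v 1 ≤ 0} (1 : EuclideanSpace ℝ (Fin 2) → ℝ)
        ((√n)⁻¹ • ∑ i, Wv c s (w i)) := by
  have h : ((√n)⁻¹ • ∑ i, Wv c s (w i)) 1 ≤ 0 ↔ _ :=
    (by simp [Wv] : _ ↔ (√n : ℝ)⁻¹ * ∑ i, ((c * (w i).1 + s * (w i).2.2)^2 - 1) ≤ 0).trans
      (sum_scale n hn (fun i => c * (w i).1 + s * (w i).2.2))
  unfold Ff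
  simp only [Set.indicator_apply, Set.mem_ofPred_eq, h, Pi.one_apply]

lemma law_integral (n : ℕ) (c s : ℝ) (S : Set (EuclideanSpace ℝ (Fin 2))) (hS : MeasurableSet S)
    (H : (Fin n → ℝ) × (Fin n → ℝ) × (Fin n → ℝ) → ℝ) (hH : Measurable H)
    (e : ∀ w : Fin n → ℝ × ℝ × ℝ, H ((fun i => (w i).1), (fun i => (w i).2.1), (fun i => (w i).2.2))
      = S.indicator 1 ((√n)⁻¹ • ∑ i, Wv c s (w i))) :
    ∫ p, H p ∂((gauss n).prod ((gauss n).prod (gauss n))) = (law c s n).real S := by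
  have mp := triple_mp (gaussianReal 0 1) n
  unfold gauss
  rw [← mp.map_eq, integral_map mp.measurable.aemeasurable hH.aestronglyMeasurable]
  simp only [e]
  rw [← integral_indicator_one hS, law, integral_map (lawMap_meas c s n).aemeasurable
      (measurable_one.indicator hS).aestronglyMeasurable]
  rfl

instance (n : ℕ) : IsProbabilityMeasure (gauss n) := by unfold gauss; infer_instance

lemma S0_meas : MeasurableSet {v : EuclideanSpace ℝ (Fin 2) | v 0 ≤ 0} :=
  measurableSet_le (by fun_prop) (by fun_prop)

lemma S1_meas : MeasurableSet {v : EuclideanSpace ℝ (Fin 2) | v 1 ≤ 0} :=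
  measurableSet_le (by fun_prop) (by fun_prop)

lemma S01_meas : MeasurableSet {v : EuclideanSpace ℝ (Fin 2) | v 0 ≤ 0 ∧ v 1 ≤ 0} := by
  convert! S0_meas.inter S1_meas using 1

lemma meas_12 {X : Type*} [MeasurableSpace X] (F : X → X → ℝ)
    (hF : Measurable (fun p : X × X => F p.1 p.2)) :
    Measurable (fun p : X × X × X => F p.1 p.2.1) :=
  hF.comp (measurable_fst.prodMk (measurable_fst.comp measurable_snd))

lemma meas_13 {X : Type*} [MeasurableSpace X] (F : X → X → ℝ)
    (hF : Measurable (fun p : X × X => F p.1 p.2)) :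
    Measurable (fun p : X × X × X => F p.1 p.2.2) :=
  hF.comp (measurable_fst.prodMk (measurable_snd.comp measurable_snd))

lemma int0 (n : ℕ) (hn : 0 < n) (c s : ℝ) :
    ∫ p, Ff n c s p.1 p.2.1 ∂((gauss n).prod ((gauss n).prod (gauss n))) =
      (law c s n).real {v : EuclideanSpace ℝ (Fin 2) | v 0 ≤ 0} := by
  have m1 : Measurable (fun p : (Fin n → ℝ) × (Fin n → ℝ) × (Fin n → ℝ) => Ff n c s p.1 p.2.1) :=
    meas_12 _ (Ff_meas n c s)
  exact law_integral n c s _ S0_meas (fun p => Ff n c s p.1 p.2.1) m1 (fun w => Ff_eq0 n hn c s w)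

lemma ind_mul (v : EuclideanSpace ℝ (Fin 2)) :
    Set.indicator {v : EuclideanSpace ℝ (Fin 2) | v 0 ≤ 0} (1 : EuclideanSpace ℝ (Fin 2) → ℝ) v *
    Set.indicator {v : EuclideanSpace ℝ (Fin 2) | v 1 ≤ 0} (1 : EuclideanSpace ℝ (Fin 2) → ℝ) v =
    Set.indicator {v : EuclideanSpace ℝ (Fin 2) | v 0 ≤ 0 ∧ v 1 ≤ 0}
      (1 : EuclideanSpace ℝ (Fin 2) → ℝ) v := by
  by_cases a : v 0 ≤ 0 <;> by_cases b : v 1 ≤ 0 <;> simp [a, b]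

lemma int01_s1 (n : ℕ) (hn : 0 < n) (c s : ℝ) :
    ∫ p, Ff n c s p.1 p.2.1 * Ff n c s p.1 p.2.2
      ∂((gauss n).prod ((gauss n).prod (gauss n))) =
      (law c s n).real {v : EuclideanSpace ℝ (Fin 2) | v 0 ≤ 0 ∧ v 1 ≤ 0} := by
  have m1 : Measurable (fun p : (Fin n → ℝ) × (Fin n → ℝ) × (Fin n → ℝ) => Ff n c s p.1 p.2.1) :=
    meas_12 _ (Ff_meas n c s)
  have m2 : Measurable (fun p : (Fin n → ℝ) × (Fin n → ℝ) × (Fin n → ℝ) => Ff n c s p.1 p.2.2) :=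
    meas_13 _ (Ff_meas n c s)
  refine law_integral n c s _ S01_meas (fun p => Ff n c s p.1 p.2.1 * Ff n c s p.1 p.2.2)
    (m1.mul m2) (fun w => ?_)
  rw [← ind_mul, ← Ff_eq0 n hn c s w, ← Ff_eq1 n hn c s w]

lemma ou_eq (t : ℝ) (n : ℕ) :
    ou n t (Set.indicator {x : Fin n → ℝ | ∑ i, (x i) ^ 2 ≤ (n : ℝ)} 1) =
      fun x => ∫ y, Ff n (rexp (-t)) (√(1 - rexp (-2*t))) x y ∂(gauss n) := by
  unfold ou Ff
  rfl

lemma gVar_eq (t : ℝ) (n : ℕ) (hn : 0 < n) :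
    gVar n (ou n t (Set.indicator {x : Fin n → ℝ | ∑ i, (x i) ^ 2 ≤ (n : ℝ)} 1)) =
      (law (rexp (-t)) (√(1 - rexp (-2*t))) n).real
        {v : EuclideanSpace ℝ (Fin 2) | v 0 ≤ 0 ∧ v 1 ≤ 0} -
      ((law (rexp (-t)) (√(1 - rexp (-2*t))) n).real
        {v : EuclideanSpace ℝ (Fin 2) | v 0 ≤ 0})^2 := by
  rw [ou_eq, ← int0 n hn, ← int01_s1 n hn]
  exact var_abs (gauss n) _ (Ff_meas n _ _) (Ff_bound n _ _)

lemma nu_open (α : ℝ) (h0 : 0 ≤ α) (h1 : α ≤ π/2) :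
    ENNReal.ofReal (1/2 - α/(2*π)) ≤ nu (cos α) (sin α) {v | v 0 < 0 ∧ v 1 < 0} := by
  refine (sheppard α h0 h1).trans (le_trans (measure_mono ?_)
    (Measure.le_map_apply (nuMap_meas _ _).aemeasurable _))
  intro p hp
  have h2 : 0 < (√2:ℝ) := by positivity
  exact ⟨mul_neg_of_pos_of_neg h2 hp.1, mul_neg_of_pos_of_neg h2 hp.2⟩
end E

theorem stmt1 (t : ℝ) (ht : 0 < t) :
    Filter.atTop.liminf (fun n : ℕ =>
      gVar n (ou n t (Set.indicator {x : Fin n → ℝ | ∑ i, (x i) ^ 2 ≤ (n : ℝ)} 1))) ≥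
      1/4 - Real.arccos (Real.exp (-2*t)) / (Real.sqrt 2 * Real.pi) := by
  have hpi := Real.pi_pos
  set c := rexp (-t) with hc
  set s := √(1 - rexp (-2*t)) with hs
  have hc0 : 0 < c := exp_pos _
  have hc2 : rexp (-2*t) = c^2 := by rw [hc, ← Real.exp_nat_mul]; congr 1; push_cast; ring
  have hlt : rexp (-2*t) < 1 := by rw [Real.exp_lt_one_iff]; linarith
  have hsp : 0 < s := Real.sqrt_pos.2 (by linarith)
  have hcs : c^2 + s^2 = 1 := by rw [hs, Real.sq_sqrt (by linarith), hc2]; ring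
  set α := arccos (c^4) with hα
  have hc41 : c^4 ≤ 1 := by
    have : c^4 = (c^2)^2 := by ring
    rw [this, ← hc2]; nlinarith [exp_pos (-2*t)]
  have hcos : cos α = c^4 := Real.cos_arccos (by linarith [pow_pos hc0 4]) hc41
  have hα0 : 0 ≤ α := arccos_nonneg _
  have hα1 : α ≤ π/2 := Real.arccos_le_pi_div_two.2 (by positivity)
  have hlim := law_tendsto c s (sin α) hcs hsp (by rw [← hcos]; linarith [sin_sq_add_cos_sq α])
  have hle : α ≤ √2 * arccos (rexp (-2*t)) := by
    have := arccos_ineq (rexp (-2*t)) (exp_pos _).le hlt.le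
    rwa [show rexp (-2*t)^2 = c^4 by rw [hc2]; ring] at this
  have hL : 1/4 - Real.arccos (Real.exp (-2*t)) / (Real.sqrt 2 * Real.pi) ≤ 1/4 - α/(2*π) := by
    have : Real.arccos (Real.exp (-2*t)) / (Real.sqrt 2 * Real.pi) =
        (√2 * arccos (rexp (-2*t))) / (2*π) := by
      have s2 : (√2:ℝ)^2 = 2 := Real.sq_sqrt (by norm_num)
      rw [div_eq_div_iff (by positivity) (by positivity)]
      linear_combination -(arccos (rexp (-2*t))) * π * s2
    rw [this]
    gcongr
  refine le_trans hL ?_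
  have hopen : IsOpen {v : EuclideanSpace ℝ (Fin 2) | v 0 < 0 ∧ v 1 < 0} :=
    (isOpen_lt (by fun_prop) (by fun_prop)).and (isOpen_lt (by fun_prop) (by fun_prop))
  have hclosed : IsClosed {v : EuclideanSpace ℝ (Fin 2) | v 0 ≤ 0} :=
    isClosed_le (by fun_prop) (by fun_prop)
  have hP := ProbabilityMeasure.le_liminf_measure_open_of_tendsto hlim hopen
  have hQ := ProbabilityMeasure.limsup_measure_closed_le_of_tendsto hlim hclosed
  have hnu := nu_open α hα0 hα1
  rw [hcos] at hnu
  change nu (c^4) (sin α) _ ≤ Filter.atTop.liminf (fun n => law c s n _) at hP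
  change Filter.atTop.limsup (fun n => law c s n _) ≤ nu (c^4) (sin α) _ at hQ
  rw [nu_closed] at hQ
  have hPQ := hnu.trans hP
  -- eventual bounds
  have key : ∀ L' < 1/4 - α/(2*π), ∀ᶠ n : ℕ in Filter.atTop, L' ≤
      gVar n (ou n t (Set.indicator {x : Fin n → ℝ | ∑ i, (x i) ^ 2 ≤ (n : ℝ)} 1)) := by
    intro L' hL'
    obtain ⟨ε, hε0, hε1, hε⟩ : ∃ ε : ℝ, 0 < ε ∧ ε < 1/4 ∧ L' ≤ 1/4 - α/(2*π) - 3 * ε := by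
      refine ⟨min (1/8) ((1/4 - α/(2*π) - L')/3), lt_min (by norm_num) (by linarith), ?_, ?_⟩
      · exact (min_le_left _ _).trans_lt (by norm_num)
      · linarith [min_le_right (1/8 : ℝ) ((1/4 - α/(2*π) - L')/3)]
    have hbase : 1/4 ≤ 1/2 - α/(2*π) := by
      have : α/(2*π) ≤ 1/4 := by rw [div_le_iff₀ (by positivity)]; linarith
      linarith
    have ev1 := Filter.eventually_lt_of_lt_liminf (lt_of_lt_of_le
      ((ENNReal.ofReal_lt_ofReal_iff (by linarith)).2
        (show 1/2 - α/(2*π) - ε < 1/2 - α/(2*π) by linarith)) hPQ)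
    have ev2 := Filter.eventually_lt_of_limsup_lt (lt_of_le_of_lt hQ
      (show (1/2 : ENNReal) < ENNReal.ofReal (1/2 + ε) by
        rw [show (1/2 : ENNReal) = ENNReal.ofReal (1/2) by
          rw [ENNReal.ofReal_div_of_pos (by norm_num)]; simp]
        exact (ENNReal.ofReal_lt_ofReal_iff (by linarith)).2 (by linarith)))
    filter_upwards [ev1, ev2, Filter.eventually_gt_atTop 0] with n h1 h2 hn
    rw [gVar_eq t n hn]
    have p1 : 1/2 - α/(2*π) - ε ≤ (law c s n).real {v | v 0 ≤ 0 ∧ v 1 ≤ 0} := by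
      have a := (ENNReal.ofReal_le_iff_le_toReal (measure_ne_top _ _)).1 h1.le
      refine a.trans (measureReal_mono ?_)
      intro v hv
      exact ⟨hv.1.le, hv.2.le⟩
    have p2 : (law c s n).real {v | v 0 ≤ 0} ≤ 1/2 + ε :=
      ENNReal.toReal_le_of_le_ofReal (by linarith) h2.le
    have p3 : 0 ≤ (law c s n).real {v | v 0 ≤ 0} := measureReal_nonneg
    have p4 : ((law c s n).real {v | v 0 ≤ 0})^2 ≤ (1/2+ε)^2 := by gcongr
    nlinarith
  have hbd : Filter.IsCoboundedUnder (· ≥ ·) Filter.atTop (fun n : ℕ =>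
      gVar n (ou n t (Set.indicator {x : Fin n → ℝ | ∑ i, (x i) ^ 2 ≤ (n : ℝ)} 1))) := by
    apply Filter.IsBoundedUnder.isCoboundedUnder_ge
    refine Filter.isBoundedUnder_of_eventually_le (a := 1) ?_
    filter_upwards [Filter.eventually_gt_atTop 0] with n hn
    rw [gVar_eq t n hn]
    have : (law c s n).real {v | v 0 ≤ 0 ∧ v 1 ≤ 0} ≤ 1 := measureReal_le_one
    nlinarith [sq_nonneg ((law c s n).real {v | v 0 ≤ 0})]
  refine le_of_forall_lt fun L' hL' => ?_
  obtain ⟨L'', h1, h2⟩ := exists_between hL'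
  exact h1.trans_le (Filter.le_liminf_of_le hbd (key L'' h2))
end

section
/- Let B_n ⊂ ℝ^n be the Euclidean ball of radius √n centered at the origin. Then for every half-space A ⊆ ℝ^n, Cov(1_{B_n}, 1_A) ≤ n^{−1/2}. -/
open MeasureTheory Real

namespace HS
open Set ProbabilityTheory

lemma gauss_density (m : ℕ) : gauss m =
    volume.withDensity (fun x : Fin m → ℝ => ENNReal.ofReal (∏ i, gaussianPDFReal 0 1 (x i))) := by
  unfold gauss
  apply Measure.pi_eq
  intro s hs
  have hint : Integrable (fun x : Fin m → ℝ => ∏ i, gaussianPDFReal 0 1 (x i)) volume :=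
    Integrable.fintype_prod (fun i => integrable_gaussianPDFReal 0 1)
  rw [withDensity_apply _ (MeasurableSet.univ_pi hs),
    ← ofReal_integral_eq_lintegral_ofReal hint.integrableOn]
  · rw [volume_pi, Measure.restrict_pi_pi,
      integral_fintype_prod_eq_prod (f := fun _ y => gaussianPDFReal 0 1 y),
      ENNReal.ofReal_prod_of_nonneg]
    · refine Finset.prod_congr rfl fun i _ => ?_
      rw [gaussianReal_apply_eq_integral _ one_ne_zero]
    · intro i _
      exact integral_nonneg (fun y => gaussianPDFReal_nonneg _ _ _)
  · exact Filter.Eventually.of_forall fun x => Finset.prod_nonneg fun i _ => gaussianPDFReal_nonneg _ _ _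

instance (m : ℕ) : IsProbabilityMeasure (gauss m) := by unfold gauss; infer_instance

lemma prod_pdf (m : ℕ) (x : Fin m → ℝ) : ∏ i, gaussianPDFReal 0 1 (x i)
    = ((√(2 * π))⁻¹) ^ m * Real.exp (-(∑ i, x i ^ 2) / 2) := by
  simp only [gaussianPDFReal_def, Finset.prod_mul_distrib, ← Real.exp_sum]
  simp [Finset.sum_div, neg_div]

/-- radial integration -/
lemma gauss_radial (m : ℕ) (hm : 0 < m) : ∃ K : ℝ, 0 ≤ K ∧ ∀ S : Set ℝ, MeasurableSet S →
    (gauss m).real {x | √(∑ i, x i ^ 2) ∈ S} =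
      K * ∫ r in Ioi (0:ℝ), r ^ (m - 1) * S.indicator (fun r => Real.exp (-r ^ 2 / 2)) r := by
  refine ⟨((√(2 * π))⁻¹) ^ m * (m * (volume : Measure (EuclideanSpace ℝ (Fin m))).real (Metric.ball 0 1)),
    by positivity, fun S hS => ?_⟩
  have hmS : MeasurableSet {x : Fin m → ℝ | √(∑ i, x i ^ 2) ∈ S} := by
    apply hS.preimage (f := fun x : Fin m → ℝ => √(∑ i, x i ^ 2))
    fun_prop
  have hint : Integrable (fun x : Fin m → ℝ => ∏ i, gaussianPDFReal 0 1 (x i)) volume :=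
    Integrable.fintype_prod (fun i => integrable_gaussianPDFReal 0 1)
  have h0 : ∀ x : Fin m → ℝ, 0 ≤ ∏ i, gaussianPDFReal 0 1 (x i) :=
    fun x => Finset.prod_nonneg fun i _ => gaussianPDFReal_nonneg _ _ _
  rw [measureReal_def, gauss_density, withDensity_apply _ hmS,
    ← ofReal_integral_eq_lintegral_ofReal hint.integrableOn (Filter.Eventually.of_forall h0),
    ENNReal.toReal_ofReal (integral_nonneg h0), ← integral_indicator hmS]
  have key : ∫ x : Fin m → ℝ, {x : Fin m → ℝ | √(∑ i, x i ^ 2) ∈ S}.indicator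
      (fun x => ∏ i, gaussianPDFReal 0 1 (x i)) x =
      ∫ x : EuclideanSpace ℝ (Fin m), ((√(2 * π))⁻¹) ^ m * S.indicator (fun r => Real.exp (-r ^ 2 / 2)) ‖x‖ := by
    rw [← (PiLp.volume_preserving_toLp (Fin m)).integral_comp
      (MeasurableEquiv.toLp 2 _).measurableEmbedding]
    congr 1
    ext x
    have hn : ‖WithLp.toLp 2 x‖ = √(∑ i, x i ^ 2) := by
      simp [EuclideanSpace.norm_eq]
    rw [hn]
    by_cases h : √(∑ i, x i ^ 2) ∈ S
    · rw [indicator_of_mem h, indicator_of_mem (by exact h), prod_pdf,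
        Real.sq_sqrt (Finset.sum_nonneg fun i _ => sq_nonneg _)]
    · rw [indicator_of_notMem h, indicator_of_notMem (by exact h), mul_zero]
  have : Nonempty (Fin m) := ⟨⟨0, hm⟩⟩
  rw [key, integral_const_mul, integral_fun_norm_addHaar]
  simp [mul_assoc]

lemma upper_pt (p : ℕ) (hp : 0 < p) (r : ℝ) (hr : 0 ≤ r) :
    r ^ p * Real.exp (-r ^ 2 / 2) ≤ (√p) ^ p * Real.exp (-(p:ℝ) / 2) := by
  have hq : 0 < √(p:ℝ) := Real.sqrt_pos.2 (by exact_mod_cast hp)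
  have hq2 : √(p:ℝ) ^ 2 = p := Real.sq_sqrt (by positivity)
  have h1 : r ≤ √p * Real.exp ((r ^ 2 / p - 1) / 2) := by
    set t := r / √p with ht
    have hrt : r = √p * t := by rw [ht]; field_simp
    have : t ≤ Real.exp ((r ^ 2 / p - 1) / 2) := by
      have e : r ^ 2 / p = t ^ 2 := by rw [ht, div_pow, hq2]
      rw [e]
      calc t ≤ (t ^ 2 - 1) / 2 + 1 := by nlinarith [sq_nonneg (t - 1)]
        _ ≤ _ := Real.add_one_le_exp _
    calc r = √p * t := hrt
      _ ≤ _ := by gcongr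
  calc r ^ p * Real.exp (-r ^ 2 / 2) ≤ (√p * Real.exp ((r ^ 2 / p - 1) / 2)) ^ p * Real.exp (-r ^ 2 / 2) := by
        gcongr
    _ = (√p) ^ p * Real.exp (-(p:ℝ) / 2) := by
        rw [mul_pow, ← Real.exp_nat_mul, mul_assoc, ← Real.exp_add]
        congr 2
        have : (p:ℝ) ≠ 0 := by positivity
        field_simp
        ring

lemma lower_pt (p : ℕ) (hp : 0 < p) (r : ℝ) (hr : √p ≤ r) :
    (√p) ^ p * Real.exp (-(p:ℝ) / 2) * √p * Real.exp (-1 * (r - √p) ^ 2) ≤ r ^ (p + 1) * Real.exp (-r ^ 2 / 2) := by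
  have hq : 0 < √(p:ℝ) := Real.sqrt_pos.2 (by exact_mod_cast hp)
  have hq2 : √(p:ℝ) ^ 2 = p := Real.sq_sqrt (by positivity)
  obtain ⟨z, hz, rfl⟩ : ∃ z : ℝ, 0 ≤ z ∧ r = √p * (1 + z) :=
    ⟨r / √p - 1, by rw [sub_nonneg, one_le_div hq]; exact hr, by field_simp; ring⟩
  have h1 : Real.exp (z - z ^ 2 / 2) ≤ 1 + z := by
    rw [← Real.le_log_iff_exp_le (by positivity)]
    refine le_trans ?_ (Real.le_log_one_add_of_nonneg hz)
    rw [le_div_iff₀ (by positivity)]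
    nlinarith [pow_nonneg hz 3]
  calc _ = (√p) ^ p * √p * (Real.exp (z - z ^ 2 / 2)) ^ p * Real.exp (-(√p * (1 + z)) ^ 2 / 2) := by
        rw [← Real.exp_nat_mul]
        have : Real.exp (-(p:ℝ) / 2) * Real.exp (-1 * (√p * (1 + z) - √p) ^ 2) =
          Real.exp (p * (z - z ^ 2 / 2)) * Real.exp (-(√p * (1 + z)) ^ 2 / 2) := by
          rw [← Real.exp_add, ← Real.exp_add]
          congr 1
          have e1 : (√p * (1 + z) - √p) ^ 2 = p * z ^ 2 := by linear_combination z ^ 2 * hq2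
          have e2 : (√p * (1 + z)) ^ 2 = p * (1 + z) ^ 2 := by rw [mul_pow, hq2]
          rw [e1, e2]; ring
        linear_combination (√p) ^ p * √p * this
    _ ≤ (√p) ^ p * √p * (1 + z) ^ p * Real.exp (-(√p * (1 + z)) ^ 2 / 2) := by gcongr
    _ ≤ (√p) ^ p * √p * ((1 + z) ^ p * (1 + z)) * Real.exp (-(√p * (1 + z)) ^ 2 / 2) := by
        rw [mul_assoc (√p ^ p * √p)]
        rw [mul_assoc (√p ^ p * √p)]
        gcongr
        exact le_mul_of_one_le_right (by positivity) (by linarith)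
    _ = _ := by rw [pow_succ (√p * (1 + z)) p, mul_pow (√p) (1 + z) p]; ring

lemma int_aux (k : ℕ) : IntegrableOn (fun r : ℝ => r ^ k * Real.exp (-r ^ 2 / 2)) (Ioi 0) := by
  have := integrableOn_rpow_mul_exp_neg_mul_sq (b := 1/2) (by norm_num) (s := (k:ℝ)) (by
    have : (0:ℝ) ≤ k := by positivity
    linarith)
  refine this.congr_fun (fun r hr => ?_) measurableSet_Ioi
  simp only [Real.rpow_natCast]
  congr 2; ring

lemma total_lower (p : ℕ) (hp : 2 ≤ p) :
    (√p) ^ p * Real.exp (-(p:ℝ) / 2) * (√(p + 3) / 2) ≤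
      ∫ r in Ioi (0:ℝ), r ^ (p + 1) * Real.exp (-r ^ 2 / 2) := by
  have hp0 : 0 < p := by omega
  set M := (√p) ^ p * Real.exp (-(p:ℝ) / 2) with hM
  have hM0 : 0 ≤ M := by positivity
  have hsh : ∫ r in Ioi (√p : ℝ), Real.exp (-1 * (r - √p) ^ 2) = √π / 2 := by
    have := integral_gaussian_Ioi 1
    rw [div_one] at this
    rw [← this, ← integral_indicator measurableSet_Ioi, ← integral_indicator measurableSet_Ioi,
      ← integral_sub_right_eq_self ((Ioi (0:ℝ)).indicator _) (√p : ℝ)]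
    congr 1
    ext x
    simp [indicator]
  have hint : Integrable (fun r : ℝ => Real.exp (-1 * (r - √p) ^ 2)) :=
    (integrable_exp_neg_mul_sq (b := 1) (by norm_num)).comp_sub_right (√p)
  calc M * (√(p + 3) / 2) ≤ M * (√p * (√π / 2)) := by
        gcongr
        rw [← mul_div_assoc, ← Real.sqrt_mul (by positivity)]
        gcongr
        have : (2:ℝ) ≤ p := by exact_mod_cast hp
        nlinarith [Real.pi_gt_three]
    _ = ∫ r in Ioi (√p : ℝ), M * √p * Real.exp (-1 * (r - √p) ^ 2) := by
        rw [integral_const_mul, hsh]; ring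
    _ ≤ ∫ r in Ioi (√p : ℝ), r ^ (p + 1) * Real.exp (-r ^ 2 / 2) := by
        apply setIntegral_mono_on
        · exact (hint.const_mul _).integrableOn
        · exact (int_aux _).mono_set (Ioi_subset_Ioi (Real.sqrt_nonneg _))
        · exact measurableSet_Ioi
        · intro r hr
          exact lower_pt p hp0 r (le_of_lt hr)
    _ ≤ _ := by
        apply setIntegral_mono_set (int_aux _)
        · filter_upwards [ae_restrict_mem measurableSet_Ioi] with r hr
          have : (0:ℝ) < r := hr
          simp only [Pi.zero_apply]; positivity
        · exact (Ioi_subset_Ioi (Real.sqrt_nonneg _)).eventuallyLE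

lemma annulus (m : ℕ) (hm : 4 ≤ m) (u v : ℝ) (hu : 0 ≤ u) (huv : u ≤ v) :
    (gauss m).real {x | √(∑ i, x i ^ 2) ∈ Ioc (√u) (√v)} ≤ (v - u) / √(m + 1) := by
  obtain ⟨p, rfl⟩ : ∃ p, m = p + 2 := ⟨m - 2, by omega⟩
  obtain ⟨K, hK, hrad⟩ := gauss_radial (p + 2) (by omega)
  have h1 := hrad univ MeasurableSet.univ
  simp only [mem_univ, ofPred_true, probReal_univ, indicator_univ] at h1
  rw [hrad _ measurableSet_Ioc]
  simp only [show p + 2 - 1 = p + 1 from rfl] at *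
  set M := (√p) ^ p * Real.exp (-(p:ℝ) / 2) with hM
  have hM0 : 0 ≤ M := by positivity
  have htot := total_lower p (by omega)
  rw [← hM] at htot
  set I := ∫ r in Ioi (0:ℝ), r ^ (p + 1) * Real.exp (-r ^ 2 / 2)
  have hup : ∫ r in Ioi (0:ℝ), r ^ (p + 1) * (Ioc (√u) (√v)).indicator (fun r => Real.exp (-r ^ 2 / 2)) r
      ≤ M * ((v - u) / 2) := by
    have hsub : √u ≤ √v := Real.sqrt_le_sqrt huv
    have e : ∫ r in Ioi (0:ℝ), r ^ (p + 1) * (Ioc (√u) (√v)).indicator (fun r => Real.exp (-r ^ 2 / 2)) r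
       = ∫ r in Ioc (√u) (√v), r ^ (p + 1) * Real.exp (-r ^ 2 / 2) := by
      have : ∀ r : ℝ, r ^ (p + 1) * (Ioc (√u) (√v)).indicator (fun r => Real.exp (-r ^ 2 / 2)) r
         = (Ioc (√u) (√v)).indicator (fun r => r ^ (p + 1) * Real.exp (-r ^ 2 / 2)) r := by
        intro r; simp [indicator]
      simp only [this]
      rw [setIntegral_indicator measurableSet_Ioc]
      congr 2
      apply inter_eq_self_of_subset_right
      intro r hr
      exact lt_of_le_of_lt (Real.sqrt_nonneg _) hr.1
    rw [e, ← intervalIntegral.integral_of_le hsub]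
    calc _ ≤ ∫ r in (√u)..(√v), M * r := by
          apply intervalIntegral.integral_mono_on hsub
          · exact Continuous.intervalIntegrable (by fun_prop) _ _
          · exact Continuous.intervalIntegrable (by fun_prop) _ _
          · intro r hr
            have hr0 : 0 ≤ r := (Real.sqrt_nonneg _).trans hr.1
            have := upper_pt p (by omega) r hr0
            calc r ^ (p + 1) * Real.exp (-r ^ 2 / 2) = (r ^ p * Real.exp (-r ^ 2 / 2)) * r := by ring
              _ ≤ M * r := by gcongr
      _ = _ := by
          rw [intervalIntegral.integral_const_mul, integral_id, Real.sq_sqrt hu, Real.sq_sqrt (hu.trans huv)]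
  have e3 : (((p + 2 : ℕ) : ℝ) + 1) = p + 3 := by push_cast; ring
  rw [e3]
  rw [le_div_iff₀ (by positivity)]
  have hs : 0 < √((p:ℝ) + 3) := by positivity
  calc _ ≤ K * (M * ((v - u) / 2)) * √((p:ℝ) + 3) := by gcongr
    _ = (v - u) * (K * (M * (√(p + 3) / 2))) := by ring
    _ ≤ (v - u) * (K * I) := by
        have : 0 ≤ v - u := by linarith
        gcongr
    _ = v - u := by rw [← h1, mul_one]

lemma gCov_ind (n : ℕ) (B A : Set (Fin n → ℝ)) (hB : MeasurableSet B) (hA : MeasurableSet A) :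
    gCov n (B.indicator 1) (A.indicator 1) =
      (gauss n).real (B ∩ A) - (gauss n).real B * (gauss n).real A := by
  have iB : Integrable (B.indicator (1 : (Fin n → ℝ) → ℝ)) (gauss n) :=
    (integrable_const (1:ℝ)).indicator hB
  have iA : Integrable (A.indicator (1 : (Fin n → ℝ) → ℝ)) (gauss n) :=
    (integrable_const (1:ℝ)).indicator hA
  have iBA : Integrable ((B ∩ A).indicator (1 : (Fin n → ℝ) → ℝ)) (gauss n) :=
    (integrable_const (1:ℝ)).indicator (hB.inter hA)
  unfold gCov gExp
  rw [integral_indicator_one hB, integral_indicator_one hA]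
  set p := (gauss n).real B
  set q := (gauss n).real A
  have : ∀ x : Fin n → ℝ, (B.indicator 1 x - p) * (A.indicator 1 x - q) =
      (B ∩ A).indicator 1 x - q * B.indicator 1 x - p * A.indicator 1 x + p * q := by
    intro x
    rw [inter_indicator_one]
    simp only [Pi.mul_apply]
    ring
  simp only [this]
  have j1 : Integrable (fun x => q * B.indicator (1 : (Fin n → ℝ) → ℝ) x) (gauss n) := iB.const_mul q
  have j2 : Integrable (fun x => p * A.indicator (1 : (Fin n → ℝ) → ℝ) x) (gauss n) := iA.const_mul p
  have j3 : Integrable (fun x => (B ∩ A).indicator (1 : (Fin n → ℝ) → ℝ) x -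
    q * B.indicator (1 : (Fin n → ℝ) → ℝ) x) (gauss n) := iBA.sub j1
  have j4 : Integrable (fun x => (B ∩ A).indicator (1 : (Fin n → ℝ) → ℝ) x -
    q * B.indicator (1 : (Fin n → ℝ) → ℝ) x - p * A.indicator (1 : (Fin n → ℝ) → ℝ) x) (gauss n) :=
    j3.sub j2
  rw [integral_add j4 (integrable_const _), integral_sub j3 j2, integral_sub iBA j1,
    integral_const_mul, integral_const_mul,
    integral_indicator_one hB, integral_indicator_one hA, integral_indicator_one (hB.inter hA)]
  simp
  ring

lemma sliver (m : ℕ) (hm : 4 ≤ m) (t : ℝ) :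
    (gauss m).real {y | ∑ i, y i ^ 2 ≤ (m:ℝ) + 1 ∧ (m:ℝ) + 1 < t ^ 2 + ∑ i, y i ^ 2} ≤
      t ^ 2 / √(m + 1) := by
  have h1 : (1:ℝ) ≤ m + 1 := by have : (0:ℝ) ≤ m := by positivity
                                linarith
  rcases le_or_gt ((m:ℝ) + 1) (t ^ 2) with h | h
  · refine measureReal_le_one.trans ?_
    rw [one_le_div (by positivity)]
    refine le_trans ?_ h
    rw [Real.sqrt_le_left (by positivity)]
    nlinarith
  · refine le_trans ?_ ((annulus m hm ((m:ℝ) + 1 - t ^ 2) (m + 1) (by linarith) (by nlinarith)).trans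
      (le_of_eq (by ring)))
    apply measureReal_mono
    · rintro y ⟨h1, h2⟩
      exact ⟨Real.sqrt_lt_sqrt (by linarith) (by linarith), Real.sqrt_le_sqrt h1⟩
    · exact measure_ne_top _ _

lemma second_moment : ∫ t, t ^ 2 ∂(gaussianReal 0 1) = 1 := by
  have h := variance_id_gaussianReal (μ := 0) (v := 1)
  rw [variance_eq_integral (by fun_prop)] at h
  simpa using h

lemma core (m : ℕ) (hm : 4 ≤ m) (b : ℝ) :
    (gauss (m + 1)).real ({x | ∑ i, x i ^ 2 ≤ (m:ℝ) + 1} ∩ {x | x 0 ≤ b}) -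
      (gauss (m + 1)).real {x | ∑ i, x i ^ 2 ≤ (m:ℝ) + 1} * (gauss (m + 1)).real {x | x 0 ≤ b}
      ≤ 1 / √(m + 1) := by
  set B := {x : Fin (m + 1) → ℝ | ∑ i, x i ^ 2 ≤ (m:ℝ) + 1} with hBdef
  set A := {x : Fin (m + 1) → ℝ | x 0 ≤ b} with hAdef
  set D := {y : Fin m → ℝ | ∑ i, y i ^ 2 ≤ (m:ℝ) + 1} with hDdef
  have hB : MeasurableSet B := measurableSet_le (by fun_prop) (by fun_prop)
  have hD : MeasurableSet D := measurableSet_le (by fun_prop) (by fun_prop)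
  have hmp : MeasurePreserving (MeasurableEquiv.piFinSuccAbove (fun _ => ℝ) 0) (gauss (m + 1))
      ((gaussianReal 0 1).prod (gauss m)) :=
    measurePreserving_piFinSuccAbove (fun _ : Fin (m + 1) => gaussianReal 0 1) 0
  have hpre : ∀ S : Set (ℝ × (Fin m → ℝ)), MeasurableSet S →
      (gauss (m + 1)).real {x | (x 0, Fin.tail x) ∈ S} =
        ((gaussianReal 0 1).prod (gauss m)).real S := by
    intro S hS
    rw [measureReal_def, measureReal_def, ← hmp.measure_preimage hS.nullMeasurableSet]
    rfl
  have hsum : ∀ x : Fin (m + 1) → ℝ, ∑ i, x i ^ 2 = x 0 ^ 2 + ∑ i, Fin.tail x i ^ 2 := by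
    intro x; rw [Fin.sum_univ_succ]; rfl
  have hAm : (gauss (m + 1)).real A = (gaussianReal 0 1).real (Iic b) := by
    have := hpre (Iic b ×ˢ univ) (measurableSet_Iic.prod MeasurableSet.univ)
    rw [measureReal_prod_prod, probReal_univ, mul_one] at this
    rw [← this]
    congr 1
    ext x; simp [hAdef]
  have hBA : (gauss (m + 1)).real (B ∩ A) ≤ (gauss m).real D * (gauss (m + 1)).real A := by
    rw [hAm, mul_comm, ← measureReal_prod_prod, ← hpre _ (measurableSet_Iic.prod hD)]
    apply measureReal_mono
    · rintro x ⟨h1, h2⟩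
      refine ⟨h2, ?_⟩
      have h1' : ∑ i, x i ^ 2 ≤ (m:ℝ) + 1 := h1
      rw [hsum] at h1'
      show ∑ i, Fin.tail x i ^ 2 ≤ (m:ℝ) + 1
      nlinarith [sq_nonneg (x 0)]
    · exact measure_ne_top _ _
  set W := {z : ℝ × (Fin m → ℝ) | ∑ i, z.2 i ^ 2 ≤ (m:ℝ) + 1 ∧ (m:ℝ) + 1 < z.1 ^ 2 + ∑ i, z.2 i ^ 2}
    with hWdef
  have hW : MeasurableSet W := by
    have w1 : MeasurableSet {z : ℝ × (Fin m → ℝ) | ∑ i, z.2 i ^ 2 ≤ (m:ℝ) + 1} :=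
      measurableSet_le (by fun_prop) (by fun_prop)
    have w2 : MeasurableSet {z : ℝ × (Fin m → ℝ) | (m:ℝ) + 1 < z.1 ^ 2 + ∑ i, z.2 i ^ 2} :=
      measurableSet_lt (by fun_prop) (by fun_prop)
    exact w1.inter w2
  have hWle : ((gaussianReal 0 1).prod (gauss m)).real W ≤ 1 / √(m + 1) := by
    rw [measureReal_def]
    apply ENNReal.toReal_le_of_le_ofReal (by positivity)
    rw [Measure.prod_apply hW]
    have hi : Integrable (fun t : ℝ => t ^ 2 / √((m:ℝ) + 1)) (gaussianReal 0 1) := by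
      have := (memLp_id_gaussianReal (μ := 0) (v := 1) 2).integrable_sq
      exact this.div_const _
    calc _ ≤ ∫⁻ t, ENNReal.ofReal (t ^ 2 / √((m:ℝ) + 1)) ∂(gaussianReal 0 1) := by
          apply lintegral_mono
          intro t
          rw [← ENNReal.toReal_le_toReal (measure_ne_top _ _) ENNReal.ofReal_ne_top,
            ENNReal.toReal_ofReal (by positivity)]
          exact sliver m hm t
      _ = _ := by
          rw [← ofReal_integral_eq_lintegral_ofReal hi (Filter.Eventually.of_forall fun t => by
            simp only [Pi.zero_apply]; positivity), integral_div, second_moment]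
  have hDB : (gauss m).real D ≤ (gauss (m + 1)).real B + 1 / √(m + 1) := by
    have e1 := hpre (univ ×ˢ D) (MeasurableSet.univ.prod hD)
    rw [measureReal_prod_prod, probReal_univ, one_mul] at e1
    rw [← e1]
    refine le_trans ?_ (add_le_add le_rfl hWle)
    rw [← hpre W hW]
    refine le_trans (measureReal_mono ?_ (measure_ne_top _ _)) (measureReal_union_le _ _)
    rintro x ⟨-, h2⟩
    by_cases h : x ∈ B
    · exact Or.inl h
    · refine Or.inr ⟨h2, ?_⟩
      show (m:ℝ) + 1 < x 0 ^ 2 + ∑ i, Fin.tail x i ^ 2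
      rw [← hsum]
      exact not_le.1 h
  have hA1 : (gauss (m + 1)).real A ≤ 1 := measureReal_le_one
  have hA0 : 0 ≤ (gauss (m + 1)).real A := measureReal_nonneg
  have hC : 0 ≤ 1 / √((m:ℝ) + 1) := by positivity
  nlinarith

/-- rotating a half-space -/
lemma rotate (m : ℕ) (a : Fin (m + 1) → ℝ) (ha : a ≠ 0) (b : ℝ) :
    ∃ b' : ℝ, ∃ φ : (Fin (m + 1) → ℝ) → (Fin (m + 1) → ℝ),
      MeasurePreserving φ (gauss (m + 1)) (gauss (m + 1)) ∧
      (∀ x, ∑ i, (φ x i) ^ 2 = ∑ i, x i ^ 2) ∧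
      (∀ x, ∑ i, x i * a i ≤ b ↔ φ x 0 ≤ b') := by
  let v : EuclideanSpace ℝ (Fin (m + 1)) := WithLp.toLp 2 a
  have hv : v ≠ 0 := by
    intro h; apply ha
    have := congrArg WithLp.ofLp h
    simpa [v] using this
  have hv0 : 0 < ‖v‖ := norm_pos_iff.2 hv
  let e : EuclideanSpace ℝ (Fin (m + 1)) := EuclideanSpace.single 0 1
  have hnorm : ‖v‖ = ‖‖v‖ • e‖ := by simp [norm_smul, e]
  let T := Submodule.reflection (ℝ ∙ (v - ‖v‖ • e))ᗮ
  have hT : T v = ‖v‖ • e := Submodule.reflection_sub hnorm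
  refine ⟨b / ‖v‖, fun x => WithLp.ofLp (T (WithLp.toLp 2 x)), ⟨by fun_prop, ?_⟩, ?_, ?_⟩
  · have h1 : (gauss (m + 1)).map (WithLp.toLp 2) = stdGaussian (EuclideanSpace ℝ (Fin (m + 1))) :=
      map_pi_eq_stdGaussian
    have h2 : (stdGaussian (EuclideanSpace ℝ (Fin (m + 1)))).map T = stdGaussian _ := stdGaussian_map T
    have h3 : (stdGaussian (EuclideanSpace ℝ (Fin (m + 1)))).map WithLp.ofLp = gauss (m + 1) := by
      rw [← h1, Measure.map_map (by fun_prop) (by fun_prop)]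
      exact Measure.map_id
    calc _ = (((gauss (m + 1)).map (WithLp.toLp 2)).map T).map WithLp.ofLp := by
          rw [Measure.map_map (by fun_prop) (by fun_prop), Measure.map_map (by fun_prop) (by fun_prop)]
          rfl
      _ = _ := by rw [h1, h2, h3]
  · intro x
    have := T.norm_map (WithLp.toLp 2 x)
    have h2 : ‖T (WithLp.toLp 2 x)‖ ^ 2 = ‖WithLp.toLp 2 x‖ ^ 2 := by rw [this]
    rw [EuclideanSpace.real_norm_sq_eq, EuclideanSpace.real_norm_sq_eq] at h2
    exact h2
  · intro x
    have h1 : inner ℝ (WithLp.toLp 2 x) v = ∑ i, x i * a i := by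
      simp [PiLp.inner_apply, v, mul_comm]
    have h2 : inner ℝ (T (WithLp.toLp 2 x)) (T v) = inner ℝ (WithLp.toLp 2 x) v := T.inner_map_map _ _
    rw [hT, inner_smul_right, h1] at h2
    have h3 : inner ℝ (T (WithLp.toLp 2 x)) e = (T (WithLp.toLp 2 x)) 0 := by
      have := EuclideanSpace.inner_single_right (𝕜 := ℝ) 0 1 (T (WithLp.toLp 2 x))
      rw [this]; simp
    rw [h3] at h2
    rw [← h2, le_div_iff₀ hv0, mul_comm]

end HS
theorem stmt2 (n : ℕ) (A : Set (Fin n → ℝ)) (hA : IsHalfspace A) :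
    gCov n (Set.indicator {x : Fin n → ℝ | ∑ i, (x i) ^ 2 ≤ (n : ℝ)} 1)
      (Set.indicator A 1) ≤ 1 / Real.sqrt n := by
  obtain ⟨a, b, rfl⟩ := hA
  have hB : MeasurableSet {x : Fin n → ℝ | ∑ i, (x i) ^ 2 ≤ (n : ℝ)} :=
    measurableSet_le (by fun_prop) (by fun_prop)
  have hA : MeasurableSet {x : Fin n → ℝ | ∑ i, x i * a i ≤ b} :=
    measurableSet_le (by fun_prop) (by fun_prop)
  rw [HS.gCov_ind n _ _ hB hA]
  rcases Nat.eq_zero_or_pos n with rfl | hn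
  · have : {x : Fin 0 → ℝ | ∑ i, (x i) ^ 2 ≤ ((0 : ℕ) : ℝ)} = Set.univ := by
      ext x; simp
    rw [this, Set.univ_inter]
    simp
  rcases le_or_gt n 16 with h16 | h16
  · set B := {x : Fin n → ℝ | ∑ i, (x i) ^ 2 ≤ (n : ℝ)}
    set A := {x : Fin n → ℝ | ∑ i, x i * a i ≤ b}
    have h1 : (gauss n).real (B ∩ A) ≤ (gauss n).real B :=
      measureReal_mono Set.inter_subset_left (measure_ne_top _ _)
    have h2 : (gauss n).real (B ∩ A) ≤ (gauss n).real A :=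
      measureReal_mono Set.inter_subset_right (measure_ne_top _ _)
    have h3 : (gauss n).real A ≤ 1 := measureReal_le_one
    have h4 : 0 ≤ (gauss n).real A := measureReal_nonneg
    have h5 : (1:ℝ) / 4 ≤ 1 / √n := by
      have : (0:ℝ) < n := by exact_mod_cast hn
      apply one_div_le_one_div_of_le (by positivity)
      rw [Real.sqrt_le_left (by norm_num)]
      have : (n:ℝ) ≤ 16 := by exact_mod_cast h16
      linarith
    refine le_trans ?_ h5
    generalize (gauss n).real (B ∩ A) = c at *
    generalize (gauss n).real A = p at *
    generalize (gauss n).real B = q at *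
    nlinarith [sq_nonneg (p - 1 / 2), mul_le_mul_of_nonneg_left h1 h4]
  obtain ⟨m, rfl⟩ : ∃ m, n = m + 1 := ⟨n - 1, by omega⟩
  by_cases ha : a = 0
  · have h0 : 0 ≤ 1 / √((m + 1 : ℕ) : ℝ) := by positivity
    by_cases hb : 0 ≤ b
    · have : {x : Fin (m + 1) → ℝ | ∑ i, x i * a i ≤ b} = Set.univ := by
        ext x; simp [ha, hb]
      rw [this]
      simpa using h0
    · have : {x : Fin (m + 1) → ℝ | ∑ i, x i * a i ≤ b} = ∅ := by
        ext x; simp [ha]; linarith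
      rw [this]
      simpa using h0
  · obtain ⟨b', φ, hφ, hnorm, hhalf⟩ := HS.rotate m a ha b
    have hcore := HS.core m (by omega) b'
    have hB' : MeasurableSet {x : Fin (m + 1) → ℝ | ∑ i, (x i) ^ 2 ≤ (m : ℝ) + 1} :=
      measurableSet_le (by fun_prop) (by fun_prop)
    have hA' : MeasurableSet {x : Fin (m + 1) → ℝ | x 0 ≤ b'} :=
      measurableSet_le (by fun_prop) (by fun_prop)
    rw [← hφ.measureReal_preimage hB'.nullMeasurableSet,
      ← hφ.measureReal_preimage hA'.nullMeasurableSet,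
      ← hφ.measureReal_preimage (hB'.inter hA').nullMeasurableSet, Set.preimage_inter] at hcore
    have eB : φ ⁻¹' {x : Fin (m + 1) → ℝ | ∑ i, (x i) ^ 2 ≤ (m : ℝ) + 1} =
        {x | ∑ i, (x i) ^ 2 ≤ ((m + 1 : ℕ) : ℝ)} := by
      ext x
      simp [hnorm]
    have eA : φ ⁻¹' {x : Fin (m + 1) → ℝ | x 0 ≤ b'} = {x | ∑ i, x i * a i ≤ b} := by
      ext x
      simp [hhalf]
    rw [eB, eA] at hcore
    simpa using hcore
end

section
/- Let f : ℝ^n → [0,1] be measurable with w₁(f) = ε² and Var(f) = σ² > 0. Then there exists a half-space A ⊆ ℝ^n such that Cov(f, 1_A) ≥ ε²/(8πσ). -/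
open MeasureTheory Real

lemma clip_eq (T g : ℝ) (hT : 0 < T) :
    ∫ t in (-T)..T, (Set.Iic g).indicator (fun _ => (1:ℝ)) t = max (-T) (min T g) + T := by
  rw [intervalIntegral.integral_of_le (by linarith), setIntegral_indicator measurableSet_Iic]
  rw [Set.Ioc_inter_Iic]
  simp only [integral_const, smul_eq_mul, mul_one, measureReal_restrict_apply_univ,
    Real.volume_real_Ioc]
  rcases le_total T g with h | h
  · rw [min_eq_left h, max_eq_right (a := -T) (by linarith), max_eq_left (by linarith)]; ring
  · rw [min_eq_right h]
    rcases le_total (-T) g with h' | h'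
    · rw [max_eq_right h', max_eq_left (by linarith)]; ring
    · rw [max_eq_left h', max_eq_right (by linarith)]; ring

lemma clip_err (T g : ℝ) (hT : 0 < T) :
    (g - max (-T) (min T g)) ^ 2 ≤ g ^ 4 / (16 * T ^ 2) := by
  have key : ∀ x : ℝ, |x| ≤ g ^ 2 / (4 * T) → x ^ 2 ≤ g ^ 4 / (16 * T ^ 2) := by
    intro x hx
    have h := pow_le_pow_left₀ (abs_nonneg x) hx 2
    rw [sq_abs] at h
    refine h.trans (le_of_eq ?_)
    field_simp
    norm_num
  apply key
  rw [le_div_iff₀ (by positivity)]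
  rcases le_total T g with h | h
  · rw [min_eq_left h, max_eq_right (by linarith), abs_of_nonneg (by linarith)]
    nlinarith [sq_nonneg (g - 2 * T)]
  · rw [min_eq_right h]
    rcases le_total (-T) g with h' | h'
    · rw [max_eq_right h']; simp; positivity
    · rw [max_eq_left h', abs_of_nonpos (by linarith)]
      nlinarith [sq_nonneg (g + 2 * T)]

lemma core {Ω : Type*} [MeasurableSpace Ω] (μ : Measure Ω) [IsProbabilityMeasure μ]
    (G h : Ω → ℝ) (hG : Measurable G) (hh : Measurable h) (hb : ∀ x, |h x| ≤ 1)
    (h0 : ∫ x, h x ∂μ = 0) (E σ : ℝ) (hE : 0 < E) (hσ : 0 < σ)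
    (hv : ∫ x, h x ^ 2 ∂μ = σ ^ 2) (hGi : Integrable G μ)
    (hGh : ∫ x, h x * G x ∂μ = E) (hG4i : Integrable (fun x => G x ^ 4) μ)
    (hG4 : ∫ x, G x ^ 4 ∂μ ≤ 80 * E ^ 2) :
    ∃ t : ℝ, E / (8 * π * σ) ≤ ∫ x, h x * (Set.Iic (G x)).indicator (fun _ => (1:ℝ)) t ∂μ := by
  by_contra! hcon
  set T : ℝ := 5 * σ with hTdef
  have hT : 0 < T := by positivity
  set c : Ω → ℝ := fun x => max (-T) (min T (G x)) with hc
  have hcm : Measurable c := by fun_prop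
  have hcb : ∀ x, |c x| ≤ T := fun x => by
    rw [abs_le]; exact ⟨le_max_left _ _, max_le (by linarith) (min_le_left _ _)⟩
  have hbd : ∀ᵐ x ∂μ, ‖h x‖ ≤ 1 := Filter.Eventually.of_forall hb
  have hhi : Integrable h μ := .of_bound hh.aestronglyMeasurable 1 hbd
  have hci : Integrable c μ :=
    .of_bound hcm.aestronglyMeasurable T (Filter.Eventually.of_forall hcb)
  have hhc : Integrable (fun x => h x * c x) μ := hci.bdd_mul hh.aestronglyMeasurable hbd
  have hhG : Integrable (fun x => h x * G x) μ := hGi.bdd_mul hh.aestronglyMeasurable hbd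
  have hh2 : Integrable (fun x => h x ^ 2) μ := by
    simpa [sq] using hhi.bdd_mul hh.aestronglyMeasurable hbd
  -- Fubini
  have hmeas : Measurable (Function.uncurry fun (x : Ω) (t : ℝ) =>
      h x * (Set.Iic (G x)).indicator (fun _ => (1:ℝ)) t) := by
    have : (Function.uncurry fun (x : Ω) (t : ℝ) =>
      h x * (Set.Iic (G x)).indicator (fun _ => (1:ℝ)) t) =
      fun p => h p.1 * ({p : Ω × ℝ | p.2 ≤ G p.1}.indicator (fun _ => (1:ℝ)) p) := by
      ext p; simp [Function.uncurry, Set.indicator]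
    rw [this]
    refine (hh.comp measurable_fst).mul (measurable_const.indicator ?_)
    exact measurableSet_le measurable_snd (hG.comp measurable_fst)
  have hbd2 : ∀ (x : Ω) (t : ℝ), ‖h x * (Set.Iic (G x)).indicator (fun _ => (1:ℝ)) t‖ ≤ 1 := by
    intro x t
    rw [norm_mul]
    have : ‖(Set.Iic (G x)).indicator (fun _ => (1:ℝ)) t‖ ≤ 1 := by
      by_cases ht : t ∈ Set.Iic (G x) <;> simp [ht]
    exact mul_le_one₀ (hb x) (norm_nonneg _) this
  have hint : Integrable (Function.uncurry fun (x : Ω) (t : ℝ) =>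
      h x * (Set.Iic (G x)).indicator (fun _ => (1:ℝ)) t)
      (μ.prod (volume.restrict (Set.Ioc (-T) T))) :=
    .of_bound hmeas.aestronglyMeasurable 1 (Filter.Eventually.of_forall fun p => hbd2 p.1 p.2)
  have hfub := integral_integral_swap hint
  have hleft : ∫ x, (∫ t in Set.Ioc (-T) T,
      h x * (Set.Iic (G x)).indicator (fun _ => (1:ℝ)) t) ∂μ = ∫ x, h x * c x ∂μ := by
    have : ∀ x, ∫ t in Set.Ioc (-T) T, h x * (Set.Iic (G x)).indicator (fun _ => (1:ℝ)) t
        = h x * c x + h x * T := by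
      intro x
      rw [integral_const_mul, ← intervalIntegral.integral_of_le (by linarith), clip_eq T _ hT]
      ring
    simp_rw [this]
    rw [integral_add hhc (hhi.mul_const T), integral_mul_const, h0]
    ring
  have hright : ∫ t in Set.Ioc (-T) T, (∫ x,
      h x * (Set.Iic (G x)).indicator (fun _ => (1:ℝ)) t ∂μ) ≤ 2 * T * (E / (8 * π * σ)) := by
    have h1 : ∫ t in Set.Ioc (-T) T, (∫ x,
      h x * (Set.Iic (G x)).indicator (fun _ => (1:ℝ)) t ∂μ) ≤
      ∫ t in Set.Ioc (-T) T, (E / (8 * π * σ)) :=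
      integral_mono hint.integral_prod_right (integrable_const _) fun t => (hcon t).le
    refine h1.trans (le_of_eq ?_)
    simp only [integral_const, smul_eq_mul, measureReal_restrict_apply_univ, Real.volume_real_Ioc]
    rw [max_eq_left (by linarith)]; ring
  rw [← hfub, hleft] at hright
  -- error term
  set l : ℝ := 9 / 20 * E / σ ^ 2 with hl
  have hlpos : 0 < l := by positivity
  have hpt : ∀ x, h x * G x ≤ h x * c x + (l / 2 * h x ^ 2 + 1 / (32 * T ^ 2 * l) * G x ^ 4) := by
    intro x
    have e1 := clip_err T (G x) hT
    have e2 : h x * (G x - c x) ≤ l / 2 * h x ^ 2 + 1 / (2 * l) * (G x - c x) ^ 2 := by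
      have : l / 2 * h x ^ 2 + 1 / (2 * l) * (G x - c x) ^ 2 - h x * (G x - c x)
        = 1 / (2 * l) * (l * h x - (G x - c x)) ^ 2 := by field_simp; ring
      have : 0 ≤ 1 / (2 * l) * (l * h x - (G x - c x)) ^ 2 := by positivity
      linarith
    have e3 : 1 / (2 * l) * (G x - c x) ^ 2 ≤ 1 / (2 * l) * (G x ^ 4 / (16 * T ^ 2)) :=
      mul_le_mul_of_nonneg_left e1 (by positivity)
    have e4 : 1 / (2 * l) * (G x ^ 4 / (16 * T ^ 2)) = 1 / (32 * T ^ 2 * l) * G x ^ 4 := by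
      field_simp; ring
    linarith
  have hI := integral_mono hhG
    (hhc.add ((hh2.const_mul (l/2)).add (hG4i.const_mul (1 / (32 * T ^ 2 * l))))) hpt
  have hI2 : ∫ x, (h x * c x + (l / 2 * h x ^ 2 + 1 / (32 * T ^ 2 * l) * G x ^ 4)) ∂μ =
      ∫ x, h x * c x ∂μ + (l / 2 * σ ^ 2 + 1 / (32 * T ^ 2 * l) * ∫ x, G x ^ 4 ∂μ) := by
    have hadd : Integrable (fun x => l / 2 * h x ^ 2 + 1 / (32 * T ^ 2 * l) * G x ^ 4) μ :=
      (hh2.const_mul (l/2)).add (hG4i.const_mul (1 / (32 * T ^ 2 * l)))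
    rw [integral_add hhc hadd,
      integral_add (hh2.const_mul (l/2)) (hG4i.const_mul (1 / (32 * T ^ 2 * l))),
      integral_const_mul, integral_const_mul, hv]
  have hI3 : E ≤ ∫ x, h x * c x ∂μ + (l / 2 * σ ^ 2 + 1 / (32 * T ^ 2 * l) * ∫ x, G x ^ 4 ∂μ) := by
    rw [← hI2, ← hGh]; exact hI
  have hI4 : 1 / (32 * T ^ 2 * l) * ∫ x, G x ^ 4 ∂μ ≤ 1 / (32 * T ^ 2 * l) * (80 * E ^ 2) :=
    mul_le_mul_of_nonneg_left hG4 (by positivity)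
  have hI5 : 1 / (32 * T ^ 2 * l) * (80 * E ^ 2) = 2 / 9 * E := by
    rw [hl, hTdef]; field_simp; norm_num
  have hI6 : l / 2 * σ ^ 2 = 9 / 40 * E := by rw [hl]; field_simp; norm_num
  have hI7 : 2 * T * (E / (8 * π * σ)) ≤ 5 / 12 * E := by
    have : 2 * T * (E / (8 * π * σ)) = 5 / 4 * E / π := by rw [hTdef]; field_simp; norm_num
    rw [this, div_le_iff₀ pi_pos]
    nlinarith [pi_gt_three]
  linarith

instance inst_s4 (n : ℕ) : IsProbabilityMeasure (gauss n) := by unfold gauss; infer_instance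

lemma mgf_lin (n : ℕ) (a : Fin n → ℝ) (s : ℝ) :
    Integrable (fun x => exp (s * ∑ i, x i * a i)) (gauss n) ∧
    ∫ x, exp (s * ∑ i, x i * a i) ∂(gauss n) = exp (s ^ 2 * (∑ i, a i ^ 2) / 2) := by
  have e : (fun x : Fin n → ℝ => exp (s * ∑ i, x i * a i)) =
      fun x => ∏ i, (fun y => exp ((s * a i) * y)) (x i) := by
    ext x
    simp only
    rw [← Real.exp_sum, Finset.mul_sum]
    congr 1
    exact Finset.sum_congr rfl fun i _ => by ring
  rw [e]
  constructor
  · exact Integrable.fintype_prod (f := fun i y => exp ((s * a i) * y))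
      fun i => ProbabilityTheory.integrable_exp_mul_gaussianReal _
  · unfold gauss
    rw [integral_fintype_prod_eq_prod (f := fun i y => exp ((s * a i) * y))]
    have : ∀ i, ∫ y, exp ((s * a i) * y) ∂(ProbabilityTheory.gaussianReal 0 1)
        = exp ((s * a i) ^ 2 / 2) := by
      intro i
      have := congrFun (ProbabilityTheory.mgf_id_gaussianReal (μ := 0) (v := 1)) (s * a i)
      simpa [ProbabilityTheory.mgf] using this
    simp_rw [this]
    rw [← Real.exp_sum, Finset.mul_sum, Finset.sum_div]
    congr 1
    exact Finset.sum_congr rfl fun i _ => by ring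

lemma fourth (n : ℕ) (a : Fin n → ℝ) (e : ℝ) (he : e ≠ 0) (ha : ∑ i, a i ^ 2 = e ^ 2) :
    Integrable (fun x => (∑ i, x i * a i) ^ 4) (gauss n) ∧
    ∫ x, (∑ i, x i * a i) ^ 4 ∂(gauss n) ≤ 80 * (e ^ 2) ^ 2 := by
  obtain ⟨i1, v1⟩ := mgf_lin n a (1 / e)
  obtain ⟨i2, v2⟩ := mgf_lin n a (-(1 / e))
  have hpt : ∀ x : Fin n → ℝ, (∑ i, x i * a i) ^ 4 ≤
      24 * e ^ 4 * (exp (1 / e * ∑ i, x i * a i) + exp (-(1 / e) * ∑ i, x i * a i)) := by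
    intro x
    set G := ∑ i, x i * a i
    have h1 := Real.pow_div_factorial_le_exp |1 / e * G| (abs_nonneg _) 4
    have h2 : exp |1 / e * G| ≤ exp (1 / e * G) + exp (-(1 / e) * G) := by
      rw [neg_mul]; exact Real.exp_abs_le _
    have h3 : |1 / e * G| ^ 4 = G ^ 4 / e ^ 4 := by
      rw [Even.pow_abs (by decide)]; field_simp
    rw [h3] at h1
    have h4 : G ^ 4 / e ^ 4 / 24 ≤ exp (1 / e * G) + exp (-(1 / e) * G) := by
      refine le_trans (le_of_eq ?_) (h1.trans h2)
      norm_num [Nat.factorial]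
    have hp : 0 < e ^ 4 := by positivity
    calc G ^ 4 = 24 * e ^ 4 * (G ^ 4 / e ^ 4 / 24) := by field_simp
      _ ≤ _ := mul_le_mul_of_nonneg_left h4 (by positivity)
  have hi := (i1.add i2).const_mul (24 * e ^ 4)
  have hI : Integrable (fun x => (∑ i, x i * a i) ^ 4) (gauss n) := by
    have hmG : Measurable (fun x : Fin n → ℝ => (∑ i, x i * a i) ^ 4) := by fun_prop
    refine hi.mono' hmG.aestronglyMeasurable (Filter.Eventually.of_forall fun x => ?_)
    rw [Real.norm_of_nonneg (by positivity)]
    exact hpt x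
  refine ⟨hI, (integral_mono hI hi hpt).trans ?_⟩
  have : ∫ x, 24 * e ^ 4 * (exp (1 / e * ∑ i, x i * a i) + exp (-(1 / e) * ∑ i, x i * a i))
      ∂(gauss n) = 48 * e ^ 4 * exp (1 / 2) := by
    rw [integral_const_mul, integral_add i1 i2, v1, v2, ha]
    have q1 : (1 / e) ^ 2 * e ^ 2 / 2 = 1 / 2 := by field_simp
    have q2 : (-(1 / e)) ^ 2 * e ^ 2 / 2 = 1 / 2 := by field_simp
    rw [q1, q2]; ring
  refine (le_of_eq this).trans ?_
  have hex : exp (1 / 2) ≤ 5 / 3 := by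
    have h := Real.exp_one_lt_d9
    have h2 : exp (1 / 2) * exp (1 / 2) = exp 1 := by rw [← Real.exp_add]; norm_num
    nlinarith [Real.exp_pos (1 / 2)]
  have hp : 0 < e ^ 4 := by positivity
  nlinarith

theorem stmt4 (n : ℕ) (f : (Fin n → ℝ) → ℝ) (ε σ : ℝ) (hf : Measurable f)
    (hrange : ∀ x, f x ∈ Set.Icc (0:ℝ) 1) (hw : w1g n f = ε ^ 2)
    (hv : gVar n f = σ ^ 2) (hσ : 0 < σ) :
    ∃ A : Set (Fin n → ℝ), IsHalfspace A ∧
      gCov n f (Set.indicator A 1) ≥ ε ^ 2 / (8 * Real.pi * σ) := by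
  have hfi : Integrable f (gauss n) := .of_bound hf.aestronglyMeasurable 1
    (Filter.Eventually.of_forall fun x => by
      rw [Real.norm_of_nonneg (hrange x).1]; exact (hrange x).2)
  set m := gExp n f with hm
  have hm0 : 0 ≤ m := integral_nonneg fun x => (hrange x).1
  have hm1 : m ≤ 1 := by
    have := integral_mono hfi (integrable_const (1:ℝ)) fun x => (hrange x).2
    simp only [integral_const, probReal_univ, smul_eq_mul, mul_one] at this
    exact this
  have h0 : ∫ x, (f x - m) ∂(gauss n) = 0 := by
    rw [integral_sub hfi (integrable_const _)]
    simp [hm, gExp]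
  have hhi : Integrable (fun x => f x - m) (gauss n) := hfi.sub (integrable_const _)
  have hcov : ∀ g : (Fin n → ℝ) → ℝ, Integrable (fun x => (f x - m) * g x) (gauss n) →
      gCov n f g = ∫ x, (f x - m) * g x ∂(gauss n) := by
    intro g hg
    unfold gCov
    rw [← hm]
    set k := gExp n g
    unfold gExp
    simp_rw [mul_sub]
    rw [integral_sub hg (hhi.mul_const k), integral_mul_const, h0]
    ring
  by_cases he : ε = 0
  · refine ⟨Set.univ, ⟨0, 0, by simp⟩, ?_⟩
    rw [he, hcov]
    · simp [h0]
    · simpa using hhi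
  set a : Fin n → ℝ := fun i => gExp n (fun x => x i * f x) with ha
  have hsum : ∑ i, a i ^ 2 = ε ^ 2 := hw
  obtain ⟨h4i, h4⟩ := fourth n a ε he hsum
  have hxi : ∀ i, Integrable (fun x : Fin n → ℝ => x i) (gauss n) := fun i => by
    unfold gauss
    exact integrable_comp_eval (X := fun _ : Fin n => ℝ)
      (μ := fun _ => ProbabilityTheory.gaussianReal 0 1) (f := fun y : ℝ => y) (i := i)
      ((ProbabilityTheory.memLp_id_gaussianReal 1).integrable le_rfl)
  have hx0 : ∀ i, ∫ x : Fin n → ℝ, x i ∂(gauss n) = 0 := fun i => by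
    unfold gauss
    refine (integral_comp_eval (X := fun _ : Fin n => ℝ)
      (μ := fun _ => ProbabilityTheory.gaussianReal 0 1) (f := fun y : ℝ => y) (i := i)
      measurable_id.aestronglyMeasurable).trans ?_
    exact ProbabilityTheory.integral_id_gaussianReal
  have hGi : Integrable (fun x : Fin n → ℝ => ∑ i, x i * a i) (gauss n) :=
    integrable_finsetSum _ fun i _ => (hxi i).mul_const _
  have hb : ∀ x, |f x - m| ≤ 1 := fun x => by
    rw [abs_le]; constructor <;> linarith [(hrange x).1, (hrange x).2]
  have hterm : ∀ i, Integrable (fun x : Fin n → ℝ => (f x - m) * x i) (gauss n) := fun i =>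
    (hxi i).bdd_mul hhi.aestronglyMeasurable (Filter.Eventually.of_forall hb)
  have hterm2 : ∀ i, ∫ x : Fin n → ℝ, (f x - m) * x i ∂(gauss n) = a i := fun i => by
    have hfx : Integrable (fun x : Fin n → ℝ => x i * f x) (gauss n) := by
      have := (hterm i).add ((hxi i).const_mul m)
      refine this.congr (Filter.Eventually.of_forall fun x => ?_)
      simp only [Pi.add_apply]; ring
    have : ∀ x : Fin n → ℝ, (f x - m) * x i = x i * f x - m * x i := fun x => by ring
    simp_rw [this]
    rw [integral_sub hfx ((hxi i).const_mul m), integral_const_mul, hx0]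
    simp [ha, gExp]
  have hGh : ∫ x, (f x - m) * (∑ i, x i * a i) ∂(gauss n) = ε ^ 2 := by
    have : ∀ x : Fin n → ℝ, (f x - m) * (∑ i, x i * a i) = ∑ i, ((f x - m) * x i) * a i := by
      intro x; rw [Finset.mul_sum]; exact Finset.sum_congr rfl fun i _ => by ring
    simp_rw [this]
    rw [integral_finsetSum _ fun i _ => (hterm i).mul_const _, ← hsum]
    refine Finset.sum_congr rfl fun i _ => ?_
    rw [integral_mul_const, hterm2]; ring
  have hvar : ∫ x, (f x - m) ^ 2 ∂(gauss n) = σ ^ 2 := by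
    rw [← hv]; simp only [gVar, gCov, sq]; rfl
  obtain ⟨t, ht⟩ := core (gauss n) (fun x => ∑ i, x i * a i) (fun x => f x - m)
    (by fun_prop) (by fun_prop) hb h0 (ε ^ 2) σ (by positivity) hσ hvar hGi hGh h4i h4
  have hA : MeasurableSet {x : Fin n → ℝ | ∑ i, x i * (-a i) ≤ -t} :=
    measurableSet_le (by fun_prop) measurable_const
  refine ⟨{x | ∑ i, x i * (-a i) ≤ -t}, ⟨fun i => -a i, -t, rfl⟩, ?_⟩
  rw [hcov]
  · refine ht.trans (le_of_eq ?_)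
    refine integral_congr_ae (Filter.Eventually.of_forall fun x => ?_)
    simp [Set.indicator]
  · have : (fun x => (f x - m) * ({x : Fin n → ℝ | ∑ i, x i * (-a i) ≤ -t}.indicator 1 x : ℝ)) =
      {x : Fin n → ℝ | ∑ i, x i * (-a i) ≤ -t}.indicator (fun x => f x - m) := by
      ext x; simp [Set.indicator]
    rw [this]
    exact hhi.indicator hA
end
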